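/- arXiv:1409.2319 — 4 statements merged into one kernel-verified Lean document; each statement's English description precedes it below -/
import Mathlib

section
/- Let S be a regular local ring of characteristic p, let 𝔄 and 𝔆 be ideals of S with 0 ≠ 𝔄 ≠ S, and let n ≥ 1, q = p^n. Then (𝔄 : 𝔆)^{[q]} = (𝔄^{[q]} : 𝔆^{[q]}), and (𝔄^{[q]} : 𝔄) ⊆ ((𝔄 : 𝔆)^{[q]} : (𝔄 : 𝔆)). -/
open TensorProduct IsLocalRing DirectSum

universe u v

/-! ### Frobenius twists and base change -/

/-- `R` viewed as an algebra over itself via the `n`-th power of the Frobenius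
endomorphism; this plays the role of `R^{(n)}` (an `R`-module via `r • s = r ^ p ^ n * s`). -/
def FrobAlg (R : Type u) (p n : ℕ) [CommRing R] [Fact p.Prime] [CharP R p] : Type u := R

namespace FrobAlg

variable (R : Type u) (p n : ℕ) [CommRing R] [Fact p.Prime] [CharP R p]

instance : CommRing (FrobAlg R p n) := inferInstanceAs (CommRing R)

instance : Algebra R (FrobAlg R p n) :=
  RingHom.toAlgebra (show R →+* FrobAlg R p n from (frobenius R p) ^ n)

/-- The canonical identification of `R` with the underlying set of `R^{(n)}`. -/
def of (r : R) : FrobAlg R p n := r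

end FrobAlg

/-- The Frobenius base change `R^{(n)} ⊗_R M` of an `R`-module `M` along the `n`-th
power of the Frobenius endomorphism of `R`. -/
def FrobBC (R : Type u) (p n : ℕ) [CommRing R] [Fact p.Prime] [CharP R p]
    (M : Type v) [AddCommGroup M] [Module R M] : Type (max u v) :=
  FrobAlg R p n ⊗[R] M

namespace FrobBC

variable (R : Type u) (p n : ℕ) [CommRing R] [Fact p.Prime] [CharP R p]
  (M : Type v) [AddCommGroup M] [Module R M]

noncomputable instance : AddCommGroup (FrobBC R p n M) :=
  inferInstanceAs (AddCommGroup (FrobAlg R p n ⊗[R] M))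

/-- The `R`-module structure on `R^{(n)} ⊗_R M` given by multiplication on the first
factor. -/
noncomputable instance : Module R (FrobBC R p n M) :=
  inferInstanceAs (Module (FrobAlg R p n) (FrobAlg R p n ⊗[R] M))

variable {M}

/-- The elementary tensor `r ⊗ m` in `R^{(n)} ⊗_R M`. -/
noncomputable def tmul (r : R) (m : M) : FrobBC R p n M := FrobAlg.of R p n r ⊗ₜ[R] m

end FrobBC

/-- `R` is `F`-pure if for every `R`-module `M` the natural map
`M → R^{(1)} ⊗_R M`, `m ↦ 1 ⊗ m`, is injective. -/
def IsFPure (R : Type u) (p : ℕ) [CommRing R] [Fact p.Prime] [CharP R p] : Prop :=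
  ∀ (M : Type u) [AddCommGroup M] [Module R M],
    Function.Injective fun m : M => FrobBC.tmul R p 1 (1 : R) m

/-- An ideal `𝔞` of `R` is fully `Φ(E)`-special if for every `n ≥ 1`, every `r ∈ 𝔞` and
every `e ∈ (0 :_E 𝔞)`, the element `r ⊗ e` is zero in `R^{(n)} ⊗_R E`. -/
def IsFullyPhiSpecial (R : Type u) (p : ℕ) [CommRing R] [Fact p.Prime] [CharP R p]
    (E : Type v) [AddCommGroup E] [Module R E] (𝔞 : Ideal R) : Prop :=
  ∀ n : ℕ, 1 ≤ n → ∀ r ∈ 𝔞, ∀ e : E, (∀ a ∈ 𝔞, a • e = 0) → FrobBC.tmul R p n r e = 0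

/-! ### The module `Φ(E)` and the Frobenius shift -/

/-- The Frobenius `a ↦ a ^ p`, as an `R`-algebra map `R^{(n)} → R^{(n+1)}`. -/
def frobStepAlg (R : Type u) (p n : ℕ) [CommRing R] [Fact p.Prime] [CharP R p] :
    FrobAlg R p n →ₐ[R] FrobAlg R p (n + 1) :=
  { (show FrobAlg R p n →+* FrobAlg R p (n + 1) from frobenius R p) with
    commutes' := fun r => by
      show frobenius R p (((frobenius R p) ^ n) r) = ((frobenius R p) ^ (n + 1)) r
      rw [pow_succ']
      rfl }

/-- The Frobenius `a ↦ a ^ p`, as an `R`-linear map `R^{(n)} → R^{(n+1)}`. -/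
def frobStep (R : Type u) (p n : ℕ) [CommRing R] [Fact p.Prime] [CharP R p] :
    FrobAlg R p n →ₗ[R] FrobAlg R p (n + 1) :=
  (frobStepAlg R p n).toLinearMap

/-- The graded module `Φ(E) = ⊕_{n ≥ 0} R^{(n)} ⊗_R E`. -/
def PhiModule (R : Type u) (p : ℕ) [CommRing R] [Fact p.Prime] [CharP R p]
    (E : Type v) [AddCommGroup E] [Module R E] : Type (max u v) :=
  ⨁ n : ℕ, FrobBC R p n E

namespace PhiModule

variable (R : Type u) (p : ℕ) [CommRing R] [Fact p.Prime] [CharP R p]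
  (E : Type v) [AddCommGroup E] [Module R E]

noncomputable instance : AddCommGroup (PhiModule R p E) :=
  inferInstanceAs (AddCommGroup (⨁ n : ℕ, FrobBC R p n E))

noncomputable instance : Module R (PhiModule R p E) :=
  inferInstanceAs (Module R (⨁ n : ℕ, FrobBC R p n E))

/-- The inclusion of the `n`-th component into `Φ(E)`. -/
noncomputable def of (n : ℕ) (g : FrobBC R p n E) : PhiModule R p E :=
  DirectSum.of (fun m : ℕ => FrobBC R p m E) n g

/-- The Frobenius-semilinear shift operator `x` on `Φ(E)`, sending an element
`r ⊗ e` of the `n`-th component to `r ^ p ⊗ e` in the `(n+1)`-th component. -/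
noncomputable def shift : PhiModule R p E →+ PhiModule R p E :=
  DirectSum.toAddMonoid fun n =>
    (DirectSum.of (fun m : ℕ => FrobBC R p m E) (n + 1)).comp
      (TensorProduct.map (frobStep R p n) (LinearMap.id (R := R) (M := E))).toAddMonoidHom

end PhiModule

/-- An ideal `𝔞` of `R` is `Φ(E)`-special if it is the annihilator of an
`R[x,f]`-submodule of `Φ(E)`, i.e. of an `R`-submodule stable under the shift operator. -/
def IsPhiSpecial (R : Type u) (p : ℕ) [CommRing R] [Fact p.Prime] [CharP R p]
    (E : Type v) [AddCommGroup E] [Module R E] (𝔞 : Ideal R) : Prop :=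
  ∃ N : Submodule R (PhiModule R p E),
    (∀ g ∈ N, PhiModule.shift R p E g ∈ N) ∧ 𝔞 = N.annihilator

/-! ### Further notions -/

/-- The `q`-th bracket (Frobenius) power `I^{[q]}` of an ideal: the ideal generated by
the `q`-th powers of the elements of `I`. -/
def Ideal.bracketPow {S : Type u} [CommRing S] (I : Ideal S) (q : ℕ) : Ideal S :=
  Ideal.span ((fun x => x ^ q) '' (I : Set S))

/-- A Noetherian local ring is regular if its maximal ideal can be generated by
`dim S` elements. -/
def IsRegularLocal (S : Type u) [CommRing S] [IsLocalRing S] : Prop :=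
  ∃ s : Finset S, (s.card : WithBot (WithTop ℕ)) = ringKrullDim S ∧
    Ideal.span (s : Set S) = maximalIdeal S

/-- An ideal `𝔟` of `R` is uniformly `F`-compatible if for every `n ≥ 1` and every
`R`-linear map `φ : R^{(n)} → R` one has `φ(𝔟) ⊆ 𝔟`. -/
def UniformlyFCompatible (R : Type u) (p : ℕ) [CommRing R] [Fact p.Prime] [CharP R p]
    (𝔟 : Ideal R) : Prop :=
  ∀ n : ℕ, 1 ≤ n → ∀ φ : FrobAlg R p n →ₗ[R] R, ∀ b ∈ 𝔟, φ (FrobAlg.of R p n b) ∈ 𝔟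

/-- `R` is `F`-finite if `R^{(1)}` is a finitely generated `R`-module. -/
def IsFFinite (R : Type u) (p : ℕ) [CommRing R] [Fact p.Prime] [CharP R p] : Prop :=
  Module.Finite R (FrobAlg R p 1)

/-- A Noetherian local ring `T` of characteristic `p` is strongly `F`-regular in the
sense of Lyubeznik and Smith if the tight closure of `0` in the injective envelope of
the residue field of `T` is zero. -/
def IsStronglyFRegularLS (T : Type u) (p : ℕ) [CommRing T] [IsLocalRing T]
    [Fact p.Prime] [CharP T p] : Prop :=
  ∀ (ET : Type u) [AddCommGroup ET] [Module T ET],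
    Module.Injective T ET →
    ∀ ι : (T ⧸ maximalIdeal T) →ₗ[T] ET, Function.Injective ι →
    (∀ N : Submodule T ET, N ⊓ LinearMap.range ι = ⊥ → N = ⊥) →
    ∀ m : ET,
      (∃ c : T, (∀ P ∈ minimalPrimes T, c ∉ P) ∧
        ∃ N₀ : ℕ, ∀ n : ℕ, N₀ ≤ n → FrobBC.tmul T p n c m = 0) → m = 0

/-- `Q` is a minimal primary decomposition of the ideal `𝔄`: the `Q i` are primary,
`𝔄` is their intersection, their radicals are pairwise distinct, and none of them
contains the intersection of the others. -/
def IsMinimalPrimaryDecomposition {S : Type u} [CommRing S] (𝔄 : Ideal S) {t : ℕ}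
    (Q : Fin t → Ideal S) : Prop :=
  𝔄 = ⨅ i, Q i ∧ (∀ i, (Q i).IsPrimary) ∧
    (Function.Injective fun i => (Q i).radical) ∧
    ∀ i, ¬ (⨅ j, ⨅ (_ : j ≠ i), Q j) ≤ Q i

section LocalCriterion

open Function LinearMap

variable {R : Type*} [CommRing R]

theorem lTensor_subtype_injective_of_sup_span_singleton (M : Type*) [AddCommGroup M] [Module R M]
    {I K : Ideal R} {v : R} (hK : ∀ s, s ∈ K ↔ s * v ∈ I)
    (hKinj : Injective (K.subtype.lTensor M))
    (hsup : Injective ((I ⊔ Ideal.span {v}).subtype.lTensor M)) :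
    Injective (I.subtype.lTensor M) := by
  set J := I ⊔ Ideal.span {v}
  have hIJ : I ≤ J := le_sup_left
  have hv : v ∈ J := Ideal.mem_sup_right (Ideal.mem_span_singleton_self v)
  let g : (I × R) →ₗ[R] J :=
    (Submodule.inclusion hIJ).coprod (LinearMap.toSpanSingleton R J ⟨v, hv⟩)
  let k : K →ₗ[R] (I × R) :=
    ((-((LinearMap.mulRight R v).comp K.subtype)).codRestrict I fun s => by
      simpa using (hK s).1 s.2).prod K.subtype
  have hg : Surjective g := by
    rintro ⟨y, hy⟩
    obtain ⟨a, ha, b, hb, rfl⟩ := Submodule.mem_sup.1 hy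
    obtain ⟨s, rfl⟩ := Ideal.mem_span_singleton'.1 hb
    exact ⟨(⟨a, ha⟩, s), Subtype.ext (by simp [g])⟩
  have hex : Exact k g := by
    rintro ⟨⟨a, ha⟩, s⟩
    constructor
    · intro h
      have h' : a + s * v = 0 := by simpa [g] using congrArg Subtype.val h
      have hs : s ∈ K := (hK s).2 (by
        rw [eq_neg_of_add_eq_zero_right h']
        exact I.neg_mem ha)
      exact ⟨⟨s, hs⟩, Prod.ext (Subtype.ext (by simp [k, eq_neg_of_add_eq_zero_left h'])) rfl⟩
    · rintro ⟨s, hs⟩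
      rw [← hs]
      exact Subtype.ext (by simp [k, g])
  rw [injective_iff_map_eq_zero]
  intro u hu
  have hu' : (Submodule.inclusion hIJ).lTensor M u = 0 := by
    apply (injective_iff_map_eq_zero _).1 hsup
    rw [← lTensor_comp_apply]
    exact hu
  obtain ⟨w, hw⟩ := (lTensor_exact M hex hg ((LinearMap.inl R I R).lTensor M u)).1 (by
    rw [← lTensor_comp_apply, LinearMap.coprod_inl]
    exact hu')
  have hw0 : w = 0 := by
    apply (injective_iff_map_eq_zero _).1 hKinj
    have := congrArg ((LinearMap.snd R I R).lTensor M) hw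
    rw [← lTensor_comp_apply, ← lTensor_comp_apply, LinearMap.snd_comp_inl, lTensor_zero] at this
    exact this
  have := congrArg ((LinearMap.fst R I R).lTensor M) hw
  rw [hw0, map_zero, map_zero, ← lTensor_comp_apply, LinearMap.fst_comp_inl, lTensor_id,
    LinearMap.id_apply] at this
  exact this.symm

theorem lTensor_subtype_injective_of_pow_maximalIdeal_le [IsNoetherianRing R] [IsLocalRing R]
    (M : Type*) [AddCommGroup M] [Module R M]
    (hM : Injective ((maximalIdeal R).subtype.lTensor M)) (n : ℕ) (I : Ideal R)
    (hI : maximalIdeal R ^ n ≤ I) : Injective (I.subtype.lTensor M) := by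
  induction I using WellFoundedGT.induction with
  | _ I ih =>
  rcases eq_or_ne I ⊤ with rfl | hI1
  · exact (Submodule.topEquiv.lTensor M).injective
  classical
  have hex : ∃ k, maximalIdeal R ^ k ≤ I := ⟨n, hI⟩
  obtain ⟨k, hk⟩ : ∃ k, Nat.find hex = k + 1 := by
    refine Nat.exists_eq_succ_of_ne_zero fun h0 => hI1 ?_
    have := Nat.find_spec hex
    rw [h0, pow_zero, Ideal.one_eq_top] at this
    exact top_le_iff.1 this
  have hk1 : maximalIdeal R ^ (k + 1) ≤ I := hk ▸ Nat.find_spec hex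
  obtain ⟨v, hv, hvI⟩ := SetLike.not_le_iff_exists.1 (Nat.find_min hex (m := k) (by omega))
  refine lTensor_subtype_injective_of_sup_span_singleton M (K := maximalIdeal R) (v := v)
    (fun s => ⟨fun hs => hk1 ?_, fun hs hu => hvI ?_⟩) hM
    (ih _ (lt_of_le_of_ne le_sup_left fun h => hvI ?_) (hI.trans le_sup_left))
  · rw [pow_succ']
    exact Ideal.mul_mem_mul hs hv
  · exact (Ideal.unit_mul_mem_iff_mem I hu).1 hs
  · rw [h]
    exact Ideal.mem_sup_right (Ideal.mem_span_singleton_self v)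

theorem mem_pow_maximalIdeal_smul_top_of_lTensor_inclusion {A : Type*} [CommRing A] [Algebra R A]
    {𝔞 : Ideal R} {𝔟 : Ideal A} (h : 𝔞.map (algebraMap R A) ≤ 𝔟) (j : ℕ) {I J : Ideal R}
    (hIJ : J ≤ I) (hJ : J ≤ 𝔞 ^ j • I) (w : A ⊗[R] J) :
    (Submodule.inclusion hIJ).lTensor A w ∈ (𝔟 ^ j • ⊤ : Submodule A (A ⊗[R] I)) := by
  induction w with
  | zero => simp
  | add x y hx hy =>
    rw [map_add]
    exact add_mem hx hy
  | tmul a y =>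
    have hpow : 𝔞 ^ j • I ≤ I := Submodule.smul_le_right
    have key : ∀ z (hz : z ∈ 𝔞 ^ j • I),
        a ⊗ₜ[R] (⟨z, hpow hz⟩ : I) ∈ (𝔟 ^ j • ⊤ : Submodule A (A ⊗[R] I)) := by
      intro z hz
      induction hz using Submodule.smul_induction_on' with
      | smul r hr n hn =>
        have : a ⊗ₜ[R] (⟨r • n, hpow (Submodule.smul_mem_smul hr hn)⟩ : I) =
            algebraMap R A r • (a ⊗ₜ[R] (⟨n, hn⟩ : I)) := by
          rw [algebraMap_smul, TensorProduct.smul_tmul', TensorProduct.smul_tmul]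
          rfl
        rw [this]
        refine Submodule.smul_mem_smul (Ideal.pow_right_mono h j ?_) Submodule.mem_top
        rw [← Ideal.map_pow]
        exact Ideal.mem_map_of_mem _ hr
      | add x hx y hy hx' hy' =>
        have := add_mem hx' hy'
        rwa [← TensorProduct.tmul_add] at this
    exact key y (hJ y.2)

/-- The local criterion for flatness. -/
theorem flat_of_lTensor_subtype_maximalIdeal_injective (A : Type*) [CommRing A] [Algebra R A]
    [IsNoetherianRing R] [IsLocalRing R] [IsNoetherianRing A] [IsLocalRing A]
    [IsLocalHom (algebraMap R A)]
    (hA : Injective ((maximalIdeal R).subtype.lTensor A)) : Module.Flat R A := by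
  rw [Module.Flat.iff_lTensor_injective']
  intro I
  rw [injective_iff_map_eq_zero]
  intro u hu
  obtain ⟨k, hk⟩ := (maximalIdeal R).exists_pow_inf_eq_pow_smul I
  suffices h : u ∈ (⨅ j : ℕ, maximalIdeal A ^ j • ⊤ : Submodule A (A ⊗[R] I)) by
    rwa [Ideal.iInf_pow_smul_eq_bot_of_isLocalRing _ (maximalIdeal.isMaximal A).ne_top,
      Submodule.mem_bot] at h
  rw [Submodule.mem_iInf]
  intro j
  set T := maximalIdeal R ^ (k + j)
  have hT : I ⊓ T ≤ maximalIdeal R ^ j • I := by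
    have := hk (k + j) (Nat.le_add_right _ _)
    rw [smul_eq_mul, Ideal.mul_top, inf_comm, Nat.add_sub_cancel_left] at this
    rw [this]
    exact smul_mono_right _ inf_le_right
  let g : (I × T) →ₗ[R] (I ⊔ T : Ideal R) :=
    (Submodule.inclusion le_sup_left).coprod (Submodule.inclusion le_sup_right)
  let f : (I ⊓ T : Ideal R) →ₗ[R] (I × T) :=
    (Submodule.inclusion inf_le_left).prod (-Submodule.inclusion inf_le_right)
  have hg : Surjective g := by
    rintro ⟨y, hy⟩
    obtain ⟨a, ha, b, hb, rfl⟩ := Submodule.mem_sup.1 hy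
    exact ⟨(⟨a, ha⟩, ⟨b, hb⟩), rfl⟩
  have hex : Exact f g := by
    rintro ⟨⟨a, ha⟩, ⟨b, hb⟩⟩
    constructor
    · intro h
      have h' : a + b = 0 := congrArg Subtype.val h
      have hab := eq_neg_of_add_eq_zero_right h'
      refine ⟨⟨a, ha, ?_⟩, Prod.ext rfl (Subtype.ext hab.symm)⟩
      rw [eq_neg_of_add_eq_zero_left h']
      exact T.neg_mem hb
    · rintro ⟨s, hs⟩
      rw [← hs]
      exact Subtype.ext (by simp [f, g])
  have hu' : (Submodule.inclusion (le_sup_left : I ≤ I ⊔ T)).lTensor A u = 0 := by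
    apply (injective_iff_map_eq_zero _).1
      (lTensor_subtype_injective_of_pow_maximalIdeal_le A hA (k + j) (I ⊔ T) le_sup_right)
    rw [← lTensor_comp_apply]
    exact hu
  obtain ⟨w, hw⟩ := (lTensor_exact A hex hg ((LinearMap.inl R I T).lTensor A u)).1 (by
    rw [← lTensor_comp_apply, LinearMap.coprod_inl]
    exact hu')
  have := congrArg ((LinearMap.fst R I T).lTensor A) hw
  rw [← lTensor_comp_apply, ← lTensor_comp_apply, LinearMap.fst_comp_inl, lTensor_id,
    LinearMap.fst_prod, LinearMap.id_apply] at this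
  rw [← this]
  exact mem_pow_maximalIdeal_smul_top_of_lTensor_inclusion
    (((local_hom_TFAE (algebraMap R A)).out 0 2).1 (inferInstance : IsLocalHom (algebraMap R A))) j inf_le_left hT w

theorem lTensor_subtype_injective_sup_span_singleton (M : Type*) [AddCommGroup M] [Module R M]
    {I : Ideal R} {x : R} (hI : Injective (I.subtype.lTensor M))
    (hx : IsSMulRegular (M ⧸ (I • ⊤ : Submodule R M)) x) :
    Injective ((I ⊔ Ideal.span {x}).subtype.lTensor M) := by
  set J := I ⊔ Ideal.span {x}
  have hIJ : I ≤ J := le_sup_left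
  have hxJ : x ∈ J := Ideal.mem_sup_right (Ideal.mem_span_singleton_self x)
  have hdecomp : ∀ u : M ⊗[R] J, ∃ (w : M ⊗[R] I) (a : M),
      u = (Submodule.inclusion hIJ).lTensor M w + a ⊗ₜ ⟨x, hxJ⟩ := by
    intro u
    induction u with
    | zero => exact ⟨0, 0, by simp⟩
    | add u v hu hv =>
      obtain ⟨w, a, rfl⟩ := hu
      obtain ⟨w', a', rfl⟩ := hv
      exact ⟨w + w', a + a', by rw [map_add, TensorProduct.add_tmul]; abel⟩
    | tmul b y =>
      obtain ⟨y, hy⟩ := y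
      obtain ⟨i, hi, z, hz, rfl⟩ := Submodule.mem_sup.1 hy
      obtain ⟨s, rfl⟩ := Ideal.mem_span_singleton'.1 hz
      refine ⟨b ⊗ₜ ⟨i, hi⟩, s • b, ?_⟩
      rw [lTensor_tmul, TensorProduct.smul_tmul, ← TensorProduct.tmul_add]
      rfl
  have hmem : ∀ a ∈ (I • ⊤ : Submodule R M),
      a ⊗ₜ[R] (⟨x, hxJ⟩ : J) ∈ LinearMap.range ((Submodule.inclusion hIJ).lTensor M) := by
    intro a ha
    induction ha using Submodule.smul_induction_on' with
    | smul r hr b _ =>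
      refine ⟨b ⊗ₜ ⟨r * x, I.mul_mem_right x hr⟩, ?_⟩
      rw [lTensor_tmul, TensorProduct.smul_tmul]
      rfl
    | add a _ b _ ha hb =>
      rw [TensorProduct.add_tmul]
      exact add_mem ha hb
  have hval : ∀ w : M ⊗[R] I,
      TensorProduct.rid R M (I.subtype.lTensor M w) ∈ (I • ⊤ : Submodule R M) := by
    intro w
    induction w with
    | zero => simp
    | add u v hu hv =>
      rw [map_add, map_add]
      exact add_mem hu hv
    | tmul b y => simpa using Submodule.smul_mem_smul y.2 Submodule.mem_top
  rw [injective_iff_map_eq_zero]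
  intro u hu
  obtain ⟨w, a, rfl⟩ := hdecomp u
  have ha : a ∈ (I • ⊤ : Submodule R M) := by
    refine mem_of_isSMulRegular_quotient_of_smul_mem hx ?_
    have h0 := congrArg (TensorProduct.rid R M) hu
    rw [map_add, map_add, ← lTensor_comp_apply,
      show J.subtype ∘ₗ Submodule.inclusion hIJ = I.subtype from rfl] at h0
    have h1 : TensorProduct.rid R M (I.subtype.lTensor M w) + x • a = 0 := by simpa using h0
    rw [eq_neg_of_add_eq_zero_right h1]
    exact neg_mem (hval w)
  obtain ⟨w', hw'⟩ := hmem a ha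
  rw [← hw', ← map_add] at hu ⊢
  rw [← lTensor_comp_apply] at hu
  rw [(injective_iff_map_eq_zero _).1 hI _ hu, map_zero]

theorem lTensor_subtype_ofList_injective (M : Type*) [AddCommGroup M] [Module R M]
    (rs : List R) (hrs : RingTheory.Sequence.IsWeaklyRegular M rs) :
    Injective ((Ideal.ofList rs).subtype.lTensor M) := by
  induction rs using List.reverseRecOn with
  | nil =>
    rw [Ideal.ofList_nil]
    intro a b _
    exact Subsingleton.elim a b
  | append_singleton rs x ih =>
    rw [RingTheory.Sequence.isWeaklyRegular_append_iff,
      RingTheory.Sequence.isWeaklyRegular_singleton_iff] at hrs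
    rw [Ideal.ofList_append, Ideal.ofList_singleton]
    exact lTensor_subtype_injective_sup_span_singleton M (ih hrs.1) hrs.2

end LocalCriterion

open RingTheory.Sequence

theorem isWeaklyRegular_map_pow {R : Type*} [CommRing R] [IsLocalRing R] [IsNoetherianRing R]
    {rs : List R} (hrs : IsWeaklyRegular R rs) (hm : ∀ r ∈ rs, r ∈ maximalIdeal R) {q : ℕ}
    (hq : q ≠ 0) : IsWeaklyRegular R (rs.map (· ^ q)) := by
  suffices h : ∀ as bs : List R, (∀ r ∈ as ++ bs, r ∈ maximalIdeal R) →
      IsWeaklyRegular R (as ++ bs) → IsWeaklyRegular R (as.map (· ^ q) ++ bs) by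
    simpa using h rs [] (by simpa using hm) (by simpa using hrs)
  intro as
  induction as with
  | nil => exact fun _ _ h => h
  | cons x as ih =>
    intro bs hmem hreg
    have hrot : IsWeaklyRegular R ((as ++ bs) ++ [x]) :=
      isWeaklyRegular_of_perm_of_subset_maximalIdeal hreg (List.perm_append_singleton x _).symm hmem
    rw [isWeaklyRegular_append_iff, isWeaklyRegular_singleton_iff] at hrot
    have hpow : IsWeaklyRegular R (as ++ (bs ++ [x ^ q])) := by
      rw [← List.append_assoc, isWeaklyRegular_append_iff, isWeaklyRegular_singleton_iff]
      exact ⟨hrot.1, hrot.2.pow q⟩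
    have hmem' : ∀ r ∈ as ++ (bs ++ [x ^ q]), r ∈ maximalIdeal R := by
      intro r hr
      simp only [List.mem_append, List.mem_singleton] at hr
      rcases hr with hr | hr | rfl
      · exact hmem r (by simp [hr])
      · exact hmem r (by simp [hr])
      · exact Ideal.pow_mem_of_mem _ (hmem x (by simp)) q (Nat.pos_of_ne_zero hq)
    have h := ih _ hmem' hpow
    rw [← List.append_assoc] at h
    refine isWeaklyRegular_of_perm_of_subset_maximalIdeal h (List.perm_append_singleton _ _) ?_
    intro r hr
    simp only [List.mem_append, List.mem_singleton, List.mem_map] at hr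
    rcases hr with (⟨s, hs, rfl⟩ | hr) | rfl
    · exact Ideal.pow_mem_of_mem _ (hmem s (by simp [hs])) q (Nat.pos_of_ne_zero hq)
    · exact hmem r (by simp [hr])
    · exact Ideal.pow_mem_of_mem _ (hmem x (by simp)) q (Nat.pos_of_ne_zero hq)

theorem exists_maximalIdeal_eq_span_singleton_sup_of_notMem_sq {R : Type*} [CommRing R]
    [IsLocalRing R] {d : ℕ} {f : Fin (d + 1) → R}
    (hf : Ideal.span (Set.range f) = maximalIdeal R) {x : R} (hx : x ∈ maximalIdeal R)
    (hx2 : x ∉ maximalIdeal R ^ 2) :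
    ∃ i : Fin (d + 1),
      maximalIdeal R = Ideal.span {x} ⊔ Ideal.span (Set.range (f ∘ i.succAbove)) := by
  have hmem : ∀ i, f i ∈ maximalIdeal R := fun i => hf ▸ Ideal.subset_span ⟨i, rfl⟩
  obtain ⟨a, ha⟩ := Ideal.mem_span_range_iff_exists_fun.1 (hf ▸ hx)
  obtain ⟨i, hi⟩ : ∃ i, IsUnit (a i) := by
    by_contra! h
    refine hx2 (ha ▸ Ideal.sum_mem _ fun i _ => ?_)
    rw [pow_two]
    exact Ideal.mul_mem_mul ((mem_maximalIdeal _).2 (h i)) (hmem i)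
  refine ⟨i, le_antisymm ?_ (sup_le ?_ ?_)⟩
  · rw [← hf, Ideal.span_le]
    rintro _ ⟨j, rfl⟩
    have hsub : ∀ k, f (i.succAbove k) ∈
        Ideal.span {x} ⊔ Ideal.span (Set.range (f ∘ i.succAbove)) :=
      fun k => Ideal.mem_sup_right (Ideal.subset_span ⟨k, rfl⟩)
    rcases Fin.eq_self_or_eq_succAbove i j with rfl | ⟨k, rfl⟩
    · rw [Fin.sum_univ_succAbove _ j] at ha
      refine (Ideal.unit_mul_mem_iff_mem _ hi).1 ?_
      rw [eq_sub_of_add_eq ha]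
      exact sub_mem (Ideal.mem_sup_left (Ideal.mem_span_singleton_self x))
        (Ideal.sum_mem _ fun k _ => Ideal.mul_mem_left _ _ (hsub k))
    · exact hsub k
  · exact (Ideal.span_singleton_le_iff_mem _).2 hx
  · rw [Ideal.span_le]
    rintro _ ⟨k, rfl⟩
    exact hmem _

theorem isDomain_of_isPrime_span_singleton {R : Type*} [CommRing R] [IsLocalRing R]
    [IsNoetherianRing R] {x : R} (hx : x ∈ maximalIdeal R) (hmin : ∀ P ∈ minimalPrimes R, x ∉ P)
    (hp : (Ideal.span {x}).IsPrime) : IsDomain R := by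
  obtain ⟨P, hP, hPx⟩ := Ideal.exists_minimalPrimes_le (I := (⊥ : Ideal R)) (J := Ideal.span {x})
    bot_le
  have hPprime : P.IsPrime := Ideal.IsMinimalPrime.isPrime hP
  have hbot : P = ⊥ := by
    refine Submodule.eq_bot_of_le_smul_of_le_jacobson_bot (maximalIdeal R) P
      (IsNoetherian.noetherian P) (fun y hy => ?_) (maximalIdeal_le_jacobson _)
    obtain ⟨z, rfl⟩ := Ideal.mem_span_singleton'.1 (hPx hy)
    rw [mul_comm]
    exact Submodule.smul_mem_smul hx ((hPprime.mem_or_mem hy).resolve_right (hmin P hP))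
  subst hbot
  exact IsDomain.of_bot_isPrime R

theorem exists_mem_maximalIdeal_notMem_sq {R : Type*} [CommRing R] [IsLocalRing R]
    [IsNoetherianRing R] (hdim : 0 < ringKrullDim R) :
    ∃ x ∈ maximalIdeal R, x ∉ maximalIdeal R ^ 2 ∧ ∀ P ∈ minimalPrimes R, x ∉ P := by
  by_contra! h
  have hfin : (insert (maximalIdeal R ^ 2) (minimalPrimes R)).Finite :=
    (minimalPrimes.finite_of_isNoetherianRing R).insert _
  have hsub : (maximalIdeal R : Set R) ⊆
      ⋃ I ∈ insert (maximalIdeal R ^ 2) (minimalPrimes R), (I : Set R) := by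
    intro x hx
    by_cases hx2 : x ∈ maximalIdeal R ^ 2
    · exact Set.mem_biUnion (Set.mem_insert _ _) hx2
    · obtain ⟨P, hP, hxP⟩ := h x hx hx2
      exact Set.mem_biUnion (Set.mem_insert_of_mem _ hP) hxP
  obtain ⟨I, hI, hle⟩ := (Ideal.subset_union_prime_finite hfin (f := id)
    (maximalIdeal R ^ 2) (maximalIdeal R ^ 2) fun I hI hne _ =>
      Ideal.IsMinimalPrime.isPrime (hI.resolve_left hne)).1 hsub
  have hmin : maximalIdeal R ∈ minimalPrimes R := by
    rcases hI with rfl | hI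
    · have hbot : maximalIdeal R = ⊥ :=
        Submodule.eq_bot_of_le_smul_of_le_jacobson_bot (maximalIdeal R) (maximalIdeal R)
          (IsNoetherian.noetherian _) (by simpa [pow_two] using hle) (maximalIdeal_le_jacobson _)
      exact ⟨⟨inferInstance, bot_le⟩, fun J _ _ => hbot ▸ bot_le⟩
    · have := Ideal.IsMinimalPrime.isPrime hI
      rwa [le_antisymm hle (le_maximalIdeal this.ne_top)]
  rw [← maximalIdeal_height_eq_ringKrullDim, Ideal.height_eq_zero_iff.2 hmin] at hdim
  exact lt_irrefl _ hdim

theorem isDomain_and_exists_isWeaklyRegular (d : ℕ) (R : Type u) [CommRing R] [IsLocalRing R]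
    [IsNoetherianRing R] (f : Fin d → R) (hf : Ideal.span (Set.range f) = maximalIdeal R)
    (hdim : (d : WithBot ℕ∞) ≤ ringKrullDim R) :
    IsDomain R ∧ ∃ rs : List R, Ideal.ofList rs = maximalIdeal R ∧ IsWeaklyRegular R rs := by
  induction d generalizing R with
  | zero =>
    have hbot : maximalIdeal R = ⊥ := by
      rw [← hf, Set.range_eq_empty, Ideal.span_empty]
    refine ⟨(isField_iff_maximalIdeal_eq.2 hbot).isDomain, [], ?_, IsWeaklyRegular.nil R R⟩
    rw [Ideal.ofList_nil, hbot]
  | succ d ih =>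
    obtain ⟨x, hx, hx2, hxmin⟩ := exists_mem_maximalIdeal_notMem_sq (R := R)
      (lt_of_lt_of_le (by exact_mod_cast Nat.succ_pos d) hdim)
    obtain ⟨i, hi⟩ := exists_maximalIdeal_eq_span_singleton_sup_of_notMem_sq hf hx hx2
    have hle : Ideal.span {x} ≤ maximalIdeal R := (Ideal.span_singleton_le_iff_mem _).2 hx
    have : Nontrivial (R ⧸ Ideal.span {x}) :=
      Ideal.Quotient.nontrivial_iff.2 fun h =>
        (maximalIdeal.isMaximal R).ne_top (top_le_iff.1 (h ▸ hle))
    have : IsLocalRing (R ⧸ Ideal.span {x}) :=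
      .of_surjective' _ Ideal.Quotient.mk_surjective
    have hmax : (maximalIdeal R).map (Ideal.Quotient.mk (Ideal.span {x})) =
        maximalIdeal (R ⧸ Ideal.span {x}) :=
      map_maximalIdeal_of_surjective _ Ideal.Quotient.mk_surjective
    have hdim' : (d : WithBot ℕ∞) ≤ ringKrullDim (R ⧸ Ideal.span {x}) := by
      have h := hdim.trans (ringKrullDim_le_ringKrullDim_quotient_add_card ({x} : Finset R)
        (by simpa [ringJacobson_eq_maximalIdeal] using hx))
      rw [Finset.coe_singleton, Finset.card_singleton, Nat.cast_add] at h
      exact ENat.WithBot.add_le_add_natCast_right_iff.1 h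
    obtain ⟨hdom, rs, hrs, hreg⟩ := ih (R ⧸ Ideal.span {x})
      (Ideal.Quotient.mk _ ∘ f ∘ i.succAbove) (by
        rw [Set.range_comp, ← Ideal.map_span, ← hmax, hi, Ideal.map_sup,
          Ideal.map_quotient_self, bot_sup_eq]) hdim'
    have hprime : (Ideal.span {x}).IsPrime := (Ideal.Quotient.isDomain_iff_prime _).1 hdom
    have hR : IsDomain R := isDomain_of_isPrime_span_singleton hx hxmin hprime
    have hx0 : x ≠ 0 := by
      rintro rfl
      exact hx2 (zero_mem _)
    obtain ⟨rs, rfl⟩ := List.map_surjective_iff.2 Ideal.Quotient.mk_surjective rs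
    refine ⟨hR, x :: rs, ?_, ?_⟩
    · rw [Ideal.ofList_cons]
      rw [← Ideal.map_ofList, ← hmax] at hrs
      have := congrArg (Ideal.comap (Ideal.Quotient.mk (Ideal.span {x}))) hrs
      rw [Ideal.comap_map_of_surjective _ Ideal.Quotient.mk_surjective,
        Ideal.comap_map_of_surjective _ Ideal.Quotient.mk_surjective, ← RingHom.ker,
        Ideal.mk_ker, sup_eq_left.2 hle] at this
      rw [sup_comm, this]
    · rw [isWeaklyRegular_cons_iff]
      refine ⟨IsSMulRegular.of_ne_zero hx0, ?_⟩
      rw [← Ideal.Quotient.algebraMap_eq, isWeaklyRegular_map_algebraMap_iff] at hreg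
      refine (LinearEquiv.isWeaklyRegular_congr (Submodule.quotEquivOfEq _ _ ?_) rs).1 hreg
      simp [← Submodule.ideal_span_singleton_smul]

theorem map_colon_of_flat {R A : Type*} [CommRing R] [CommRing A] [Algebra R A] [Module.Flat R A]
    (I J : Ideal R) (hJ : J.FG) :
    (Submodule.colon I (J : Set R)).map (algebraMap R A) =
      Submodule.colon (I.map (algebraMap R A)) (J.map (algebraMap R A) : Set A) := by
  apply le_antisymm
  · rw [Ideal.map_le_iff_le_comap]
    intro r hr
    rw [Ideal.mem_comap, Submodule.mem_colon]
    suffices J.map (algebraMap R A) ≤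
        Submodule.colon (I.map (algebraMap R A)) {algebraMap R A r} by
      intro a ha
      rw [smul_eq_mul, mul_comm]
      exact Submodule.mem_colon_singleton.1 (this ha)
    rw [Ideal.map_le_iff_le_comap]
    intro c hc
    rw [Ideal.mem_comap, Submodule.mem_colon_singleton, smul_eq_mul, ← map_mul, mul_comm]
    exact Ideal.mem_map_of_mem _ (Submodule.mem_colon.1 hr c hc)
  · intro a ha
    classical
    obtain ⟨s, rfl⟩ := hJ
    let f : R →ₗ[R] (s → R ⧸ I) := LinearMap.pi fun c =>
      (Submodule.mkQ I).comp (LinearMap.mulRight R (c : R))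
    set K := Submodule.colon I (Ideal.span (s : Set R) : Set R)
    have hex : Function.Exact K.subtype f := by
      intro r
      rw [Submodule.coe_subtype, Subtype.range_coe, SetLike.mem_coe,
        show K = Submodule.colon I (s : Set R) from Submodule.colon_span, Submodule.mem_colon]
      simp only [funext_iff, f, LinearMap.pi_apply, LinearMap.comp_apply, Submodule.mkQ_apply,
        LinearMap.mulRight_apply, Pi.zero_apply, Submodule.Quotient.mk_eq_zero, smul_eq_mul,
        Subtype.forall, SetLike.mem_coe]
    have hzero : ∀ b ∈ I.map (algebraMap R A), b ⊗ₜ[R] (Submodule.mkQ I 1) = 0 := by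
      intro b hb
      induction hb using Submodule.span_induction with
      | mem x hx =>
        obtain ⟨r, hr, rfl⟩ := hx
        rw [Algebra.algebraMap_eq_smul_one, TensorProduct.smul_tmul, ← map_smul,
          Submodule.mkQ_apply, (Submodule.Quotient.mk_eq_zero I).2 (by simpa using hr),
          TensorProduct.tmul_zero]
      | zero => simp
      | add x y _ _ hx hy => rw [TensorProduct.add_tmul, hx, hy, add_zero]
      | smul t x _ hx =>
        rw [← TensorProduct.smul_tmul', hx, smul_zero]
    obtain ⟨w, hw⟩ := (Module.Flat.lTensor_exact A hex (a ⊗ₜ 1)).1 (by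
      apply (TensorProduct.piRight R R A (fun _ : s => R ⧸ I)).injective
      rw [map_zero]
      ext c
      rw [LinearMap.lTensor_tmul, TensorProduct.piRight_apply, TensorProduct.piRightHom_tmul,
        Pi.zero_apply]
      have h1 : f 1 c = (c : R) • Submodule.mkQ I 1 := by
        rw [← map_smul]
        simp [f]
      change a ⊗ₜ[R] f 1 c = 0
      rw [h1, ← TensorProduct.smul_tmul, ← hzero _ (Submodule.mem_colon.1 ha _
        (Ideal.mem_map_of_mem _ (Ideal.subset_span c.2))), smul_eq_mul, Algebra.smul_def, mul_comm])
    have hval : ∀ w : A ⊗[R] K,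
        TensorProduct.rid R A (K.subtype.lTensor A w) ∈ K.map (algebraMap R A) := by
      intro w
      induction w with
      | zero => simp
      | add x y hx hy =>
        rw [map_add, map_add]
        exact add_mem hx hy
      | tmul b k =>
        rw [LinearMap.lTensor_tmul, TensorProduct.rid_tmul, Algebra.smul_def]
        exact Ideal.mul_mem_right _ _ (Ideal.mem_map_of_mem _ k.2)
    simpa [hw] using hval w

instance (R : Type u) (p n : ℕ) [CommRing R] [Fact p.Prime] [CharP R p] [IsLocalRing R] :
    IsLocalRing (FrobAlg R p n) := inferInstanceAs (IsLocalRing R)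

instance (R : Type u) (p n : ℕ) [CommRing R] [Fact p.Prime] [CharP R p] [IsNoetherianRing R] :
    IsNoetherianRing (FrobAlg R p n) := inferInstanceAs (IsNoetherianRing R)

theorem FrobAlg.algebraMap_apply {R : Type u} (p n : ℕ) [CommRing R] [Fact p.Prime] [CharP R p]
    (r : R) : algebraMap R (FrobAlg R p n) r = FrobAlg.of R p n (r ^ p ^ n) :=
  show (frobenius R p ^ n) r = r ^ p ^ n by
    rw [RingHom.coe_pow, iterate_frobenius]

instance (R : Type u) (p n : ℕ) [CommRing R] [Fact p.Prime] [CharP R p] :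
    IsLocalHom (algebraMap R (FrobAlg R p n)) where
  map_nonunit r hr := by
    rw [FrobAlg.algebraMap_apply] at hr
    exact (isUnit_pow_iff (pow_ne_zero n (Fact.out : p.Prime).ne_zero)).1
      (show IsUnit (r ^ p ^ n) from hr)

theorem IsRegularLocal.flat_frobAlg {S : Type u} [CommRing S] [IsNoetherianRing S] [IsLocalRing S]
    (p n : ℕ) [Fact p.Prime] [CharP S p] (hreg : IsRegularLocal S) :
    Module.Flat S (FrobAlg S p n) := by
  obtain ⟨s, hs, hspan⟩ := hreg
  obtain ⟨-, rs, hrs, hw⟩ := isDomain_and_exists_isWeaklyRegular s.card S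
    ((fun x : s => (x : S)) ∘ s.equivFin.symm)
    (by rw [← hspan, s.equivFin.symm.surjective.range_comp]; simp) hs.le
  apply flat_of_lTensor_subtype_maximalIdeal_injective
  rw [← hrs]
  apply lTensor_subtype_ofList_injective
  rw [← isWeaklyRegular_map_algebraMap_iff (FrobAlg S p n)]
  have h := isWeaklyRegular_map_pow hw
    (fun r hr => hrs ▸ Ideal.subset_span hr) (pow_ne_zero n (Fact.out : p.Prime).ne_zero)
  have hmap : rs.map (algebraMap S (FrobAlg S p n)) =
      rs.map fun r => FrobAlg.of S p n (r ^ p ^ n) :=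
    List.map_congr_left fun r _ => FrobAlg.algebraMap_apply p n r
  rw [hmap]
  exact h

theorem Ideal.bracketPow_eq_map {S : Type u} [CommRing S] (p n : ℕ) [Fact p.Prime] [CharP S p]
    (I : Ideal S) :
    (I.bracketPow (p ^ n) : Ideal S) = I.map (algebraMap S (FrobAlg S p n)) :=
  show I.bracketPow (p ^ n) = Ideal.span (algebraMap S (FrobAlg S p n) '' I) from
    congrArg Ideal.span (Set.image_congr fun r _ => (FrobAlg.algebraMap_apply p n r).symm)

theorem bracket_pow_colon (S : Type u) [CommRing S] [IsNoetherianRing S] [IsLocalRing S]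
    (p : ℕ) [Fact p.Prime] [CharP S p] (hreg : IsRegularLocal S)
    (𝔄 𝔆 : Ideal S) (h0 : 𝔄 ≠ ⊥) (h1 : 𝔄 ≠ ⊤) (n : ℕ) (hn : 1 ≤ n) :
    Ideal.bracketPow (Submodule.colon 𝔄 𝔆) (p ^ n) =
        Submodule.colon (Ideal.bracketPow 𝔄 (p ^ n)) (Ideal.bracketPow 𝔆 (p ^ n)) ∧
      Submodule.colon (Ideal.bracketPow 𝔄 (p ^ n)) 𝔄 ≤
        Submodule.colon (Ideal.bracketPow (Submodule.colon 𝔄 𝔆) (p ^ n))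
          (Submodule.colon 𝔄 𝔆) := by
  have hflat := hreg.flat_frobAlg p n
  have hcolon : Ideal.bracketPow (Submodule.colon 𝔄 𝔆) (p ^ n) =
      Submodule.colon (Ideal.bracketPow 𝔄 (p ^ n)) (Ideal.bracketPow 𝔆 (p ^ n)) := by
    rw [Ideal.bracketPow_eq_map p n, Ideal.bracketPow_eq_map p n, Ideal.bracketPow_eq_map p n]
    exact map_colon_of_flat 𝔄 𝔆 (IsNoetherian.noetherian 𝔆)
  refine ⟨hcolon, fun r hr => Submodule.mem_colon.2 fun x hx => ?_⟩
  rw [hcolon, Ideal.bracketPow.eq_1 𝔆, Ideal.span, Submodule.colon_span, Submodule.mem_colon]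
  rintro _ ⟨c, hc, rfl⟩
  have hq : p ^ n ≠ 0 := pow_ne_zero n (Fact.out : p.Prime).ne_zero
  have hxc : r * (x * c) ∈ Ideal.bracketPow 𝔄 (p ^ n) :=
    Submodule.mem_colon.1 hr _ (Submodule.mem_colon.1 hx c hc)
  have heq : (r • x) • c ^ p ^ n = r * (x * c) * c ^ (p ^ n - 1) := by
    rw [← mul_pow_sub_one hq c, smul_eq_mul, smul_eq_mul]
    ring
  exact heq ▸ Ideal.mul_mem_right _ _ hxc
end

section
/- Let S be a regular local ring of characteristic p, let 𝔄 be an ideal of S with 0 ≠ 𝔄 ≠ S, and let n ≥ 1, q = p^n. If 𝔓 is an associated prime of 𝔄 (that is, an associated prime of the S-module S/𝔄), then (𝔄^{[q]} : 𝔄) ⊆ (𝔓^{[q]} : 𝔓). -/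
open TensorProduct IsLocalRing DirectSum

universe u v

section Regular

variable {R : Type u} [CommRing R] [IsLocalRing R]

theorem IsLocalRing.ringKrullDim_le_length_of_ofList_eq_maximalIdeal [IsNoetherianRing R]
    {xs : List R}
    (h : Ideal.ofList xs = maximalIdeal R) : ringKrullDim R ≤ xs.length := by
  classical
  refine (ringKrullDim_le_spanFinrank_maximalIdeal R).trans ?_
  rw [← h]
  have hs : ({r | r ∈ xs} : Set R) = (xs.toFinset : Set R) := by ext; simp
  have := Submodule.spanFinrank_span_le_ncard_of_finite (R := R)
    (s := {r | r ∈ xs}) (by rw [hs]; exact xs.toFinset.finite_toSet)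
  rw [hs, Set.ncard_coe_finset] at this
  have h2 := this.trans xs.toFinset_card_le
  rw [← hs] at h2
  exact_mod_cast h2

theorem Ideal.ofList_map_quotient_mk_eq_maximalIdeal {x : R} {xs : List R}
    [IsLocalRing (R ⧸ Ideal.span {x})]
    (h : Ideal.ofList (x :: xs) = maximalIdeal R) :
    Ideal.ofList (xs.map (Ideal.Quotient.mk (Ideal.span {x}))) =
      maximalIdeal (R ⧸ Ideal.span {x}) := by
  rw [← IsLocalRing.map_maximalIdeal_of_surjective _ Ideal.Quotient.mk_surjective, ← h,
    Ideal.ofList_cons, Ideal.map_sup, Ideal.map_ofList, Ideal.map_span]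
  simp

theorem IsLocalRing.mem_maximalIdeal_of_ofList_cons {x : R} {xs : List R}
    (h : Ideal.ofList (x :: xs) = maximalIdeal R) : x ∈ maximalIdeal R :=
  h ▸ Ideal.subset_span (by simp)

theorem IsLocalRing.length_le_ringKrullDim_quotient [IsNoetherianRing R] {x : R} {xs : List R}
    (h : Ideal.ofList (x :: xs) = maximalIdeal R)
    (hdim : ((x :: xs).length : WithBot ℕ∞) ≤ ringKrullDim R) :
    (xs.length : WithBot ℕ∞) ≤ ringKrullDim (R ⧸ Ideal.span {x}) := by
  have h1 := hdim.trans
    (ringKrullDim_le_ringKrullDim_quotSMulTop_succ (mem_maximalIdeal_of_ofList_cons h))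
  rw [← Submodule.ideal_span_singleton_smul, smul_eq_mul, Ideal.mul_top] at h1
  push_cast [List.length_cons] at h1
  exact (ENat.WithBot.add_le_add_one_right_iff).1 h1

theorem exists_isPrime_le_ringKrullDim_quotient {R : Type u} [CommRing R] {d : ℕ}
    (h : (d : WithBot ℕ∞) ≤ ringKrullDim R) :
    ∃ Q : Ideal R, Q.IsPrime ∧ (d : WithBot ℕ∞) ≤ ringKrullDim (R ⧸ Q) := by
  obtain ⟨l, hl⟩ := Order.le_krullDim_iff.1 h
  refine ⟨l.head.asIdeal, l.head.isPrime, ?_⟩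
  rw [ringKrullDim_quotient]
  refine Order.le_krullDim_iff.2 ⟨⟨l.length, fun i => ⟨l i, ?_⟩, fun i => l.step i⟩, hl⟩
  exact l.head_le i

/-- A Noetherian local ring whose maximal ideal is generated by at most `dim R` elements is a
domain. -/
theorem IsLocalRing.isDomain_of_ofList_eq_maximalIdeal [IsNoetherianRing R] (xs : List R)
    (h : Ideal.ofList xs = maximalIdeal R) (hdim : (xs.length : WithBot ℕ∞) ≤ ringKrullDim R) :
    IsDomain R := by
  induction hd : xs.length generalizing R xs with
  | zero =>
    obtain rfl := List.length_eq_zero_iff.1 hd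
    rw [Ideal.ofList_nil] at h
    exact (isField_iff_maximalIdeal_eq.2 h.symm).isDomain
  | succ d ih =>
    obtain ⟨x, xs, rfl⟩ := List.exists_cons_of_length_eq_add_one hd
    have hx := mem_maximalIdeal_of_ofList_cons h
    have hne : Ideal.span {x} ≠ ⊤ := by
      rwa [Ne, Ideal.span_singleton_eq_top]
    have : Nontrivial (R ⧸ Ideal.span {x}) := Ideal.Quotient.nontrivial_iff.2 hne
    have : IsLocalRing (R ⧸ Ideal.span {x}) :=
      .of_surjective' _ Ideal.Quotient.mk_surjective
    have hm := Ideal.ofList_map_quotient_mk_eq_maximalIdeal h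
    have hle := length_le_ringKrullDim_quotient h hdim
    have hge := ringKrullDim_le_length_of_ofList_eq_maximalIdeal hm
    rw [List.length_map] at hge
    have hD : IsDomain (R ⧸ Ideal.span {x}) :=
      ih _ hm (by simpa using hle) (by simpa using hd)
    obtain ⟨Q, hQ, hQd⟩ := exists_isPrime_le_ringKrullDim_quotient hdim
    have hlt : ¬ ((xs.length : WithBot ℕ∞) + 1 ≤ xs.length) := by
      norm_cast; simp
    push_cast [List.length_cons] at hQd
    have hxQ : x ∉ Q := fun hxQ => hlt <| (hQd.trans (ringKrullDim_le_of_surjective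
      (Ideal.Quotient.factor ((Ideal.span_singleton_le_iff_mem Q).2 hxQ))
      (Ideal.Quotient.factor_surjective _))).trans hge
    have hQx : Q ≤ Ideal.span {x} := by
      intro r hr
      by_contra hrx
      have h1 : ringKrullDim (R ⧸ Q ⊔ Ideal.span {x}) + 1 ≤ ringKrullDim (R ⧸ Ideal.span {x}) :=
        ringKrullDim_succ_le_of_surjective
          (Ideal.Quotient.factor le_sup_right) (Ideal.Quotient.factor_surjective _)
          (r := Ideal.Quotient.mk _ r)
          (mem_nonZeroDivisors_of_ne_zero (by rwa [Ne, Ideal.Quotient.eq_zero_iff_mem]))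
          (by
            rw [Ideal.Quotient.factor_mk, Ideal.Quotient.eq_zero_iff_mem]
            exact Ideal.mem_sup_left hr)
      have : Nontrivial (R ⧸ Q) := Ideal.Quotient.nontrivial_iff.2 hQ.ne_top
      have : IsLocalRing (R ⧸ Q) := .of_surjective' _ Ideal.Quotient.mk_surjective
      have h2 : ringKrullDim (R ⧸ Q) ≤
          ringKrullDim ((R ⧸ Q) ⧸ Ideal.span {Ideal.Quotient.mk Q x}) + 1 := by
        have := ringKrullDim_le_ringKrullDim_quotSMulTop_succ (R := R ⧸ Q)
          (x := Ideal.Quotient.mk Q x) (by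
            rw [← IsLocalRing.map_maximalIdeal_of_surjective _ Ideal.Quotient.mk_surjective]
            exact Ideal.mem_map_of_mem _ hx)
        rwa [← Submodule.ideal_span_singleton_smul, smul_eq_mul, Ideal.mul_top] at this
      rw [← Set.image_singleton, ← Ideal.map_span,
        ringKrullDim_eq_of_ringEquiv (DoubleQuot.quotQuotEquivQuotSup Q _)] at h2
      exact hlt ((hQd.trans (h2.trans h1)).trans hge)
    have hQ0 : Q = ⊥ := by
      refine Submodule.eq_bot_of_le_smul_of_le_jacobson_bot (Ideal.span {x}) Q
        (IsNoetherian.noetherian Q) ?_ ?_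
      · intro y hy
        obtain ⟨a, rfl⟩ := Ideal.mem_span_singleton'.1 (hQx hy)
        have ha := (hQ.mem_or_mem hy).resolve_right hxQ
        rw [mul_comm]
        exact Submodule.smul_mem_smul (Ideal.mem_span_singleton_self x) ha
      · rw [IsLocalRing.jacobson_eq_maximalIdeal _ bot_ne_top]
        exact (Ideal.span_singleton_le_iff_mem _).2 hx
    subst hQ0
    exact IsDomain.of_bot_isPrime R

end Regular

section FrobeniusSyzygies

open Matrix

section Defs

variable {R : Type u} [CommRing R] {ι : Type*}

/-- The vectors `g` with `∑ i, f i * g i ∈ J`. -/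
def syzygiesMod [Fintype ι] (f : ι → R) (J : Ideal R) : Submodule R (ι → R) :=
  Submodule.comap (dotProductBilin R R f) J

theorem mem_syzygiesMod [Fintype ι] {f : ι → R} {J : Ideal R} {g : ι → R} :
    g ∈ syzygiesMod f J ↔ f ⬝ᵥ g ∈ J :=
  Iff.rfl

/-- The submodule generated by the coordinatewise `q`-th powers of the elements of `N`. -/
def Submodule.coordPow (N : Submodule R (ι → R)) (q : ℕ) : Submodule R (ι → R) :=
  span R ((· ^ q) '' (N : Set (ι → R)))

theorem Submodule.pow_mem_coordPow {N : Submodule R (ι → R)} {g : ι → R} (hg : g ∈ N) (q : ℕ) :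
    g ^ q ∈ N.coordPow q :=
  subset_span ⟨g, hg, rfl⟩

theorem Submodule.mem_coordPow_iff {N : Submodule R (ι → R)} {q : ℕ} {a : ι → R} :
    a ∈ N.coordPow q ↔ ∃ (m : ℕ) (b : Fin m → R) (g : Fin m → ι → R),
      (∀ j, g j ∈ N) ∧ ∑ j, b j • g j ^ q = a := by
  constructor
  · intro h
    obtain ⟨m, b, g, rfl⟩ := mem_span_set'.1 h
    choose g' hg' hgg using fun j => (g j).2
    exact ⟨m, b, g', hg', Finset.sum_congr rfl fun j _ => congrArg _ (hgg j)⟩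
  · rintro ⟨m, b, g, hg, rfl⟩
    exact sum_mem fun j _ => smul_mem _ _ (pow_mem_coordPow (hg j) q)

variable (R) in
/-- Every linear relation on `q`-th powers comes from the `q`-th powers of linear relations. When
`q` is a power of the characteristic, this says that the corresponding iterate of Frobenius is
flat. -/
def PowSyzygiesGenerated (q : ℕ) : Prop :=
  ∀ (k : ℕ) (f : Fin k → R), syzygiesMod (f ^ q) ⊥ ≤ (syzygiesMod f ⊥).coordPow q

end Defs

variable {R : Type u} [CommRing R] {p : ℕ} [Fact p.Prime] [CharP R p] {n : ℕ}

theorem pow_dotProduct_pow_charP {ι : Type*} [Fintype ι] (f g : ι → R) :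
    (f ^ p ^ n) ⬝ᵥ (g ^ p ^ n) = (f ⬝ᵥ g) ^ p ^ n := by
  simp only [dotProduct, sum_pow_char_pow, Pi.pow_apply, mul_pow]

theorem dotProduct_mem_of_mem_coordPow {ι : Type*} [Fintype ι] {f a : ι → R} {y : R}
    (ha : a ∈ (syzygiesMod f (Ideal.span {y})).coordPow (p ^ n)) :
    (f ^ p ^ n) ⬝ᵥ a ∈ Ideal.span {y ^ p ^ n} := by
  suffices (syzygiesMod f (Ideal.span {y})).coordPow (p ^ n) ≤
    syzygiesMod (f ^ p ^ n) (Ideal.span {y ^ p ^ n}) from mem_syzygiesMod.1 (this ha)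
  refine Submodule.span_le.2 ?_
  rintro _ ⟨g, hg, rfl⟩
  obtain ⟨c, hc⟩ := Ideal.mem_span_singleton.1 (mem_syzygiesMod.1 hg)
  refine mem_syzygiesMod.2 (Ideal.mem_span_singleton.2 ⟨c ^ p ^ n, ?_⟩)
  rw [pow_dotProduct_pow_charP, hc, mul_pow]

theorem pow_smul_mem_coordPow {ι : Type*} [Fintype ι] {N : Submodule R (ι → R)} {x : R}
    (hx : ∀ a, x • a ∈ N) {q : ℕ} (hq : q ≠ 0) (a : ι → R) : x ^ q • a ∈ N.coordPow q := by
  classical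
  rw [pi_eq_sum_univ' a, Finset.smul_sum]
  refine sum_mem fun i _ => ?_
  rw [smul_comm]
  refine Submodule.smul_mem _ _ ?_
  convert Submodule.pow_mem_coordPow (hx (Pi.single i 1)) q using 1
  ext j
  by_cases h : j = i
  · subst h; simp
  · simp [h, hq]

section Quotient

variable {x : R}

theorem exists_mem_coordPow_add_smul {q : ℕ} (hR : PowSyzygiesGenerated (R ⧸ Ideal.span {x}) q)
    {k : ℕ} {f a : Fin k → R} (ha : f ^ q ⬝ᵥ a ∈ Ideal.span {x}) :
    ∃ l ∈ (syzygiesMod f (Ideal.span {x})).coordPow q, ∃ a', a = l + x • a' := by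
  let π := Ideal.Quotient.mk (Ideal.span {x})
  have h := hR k (π ∘ f) (x := π ∘ a) (by
    rw [mem_syzygiesMod, Ideal.mem_bot, ← Ideal.Quotient.eq_zero_iff_mem.2 ha,
      RingHom.map_dotProduct]
    congr 1)
  obtain ⟨m, b, g, hg, hsum⟩ := Submodule.mem_coordPow_iff.1 h
  choose b' hb' using fun j => Ideal.Quotient.mk_surjective (b j)
  choose g' hg' using fun j i => Ideal.Quotient.mk_surjective (g j i)
  have hdvd : ∀ i, x ∣ a i - (∑ j, b' j • g' j ^ q) i := by
    intro i
    rw [← Ideal.mem_span_singleton, ← Ideal.Quotient.eq_zero_iff_mem, map_sub, sub_eq_zero]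
    have := congrFun hsum i
    simp only [Finset.sum_apply, Pi.smul_apply, Pi.pow_apply, smul_eq_mul, map_sum, map_mul,
      map_pow, hb', hg', Function.comp_apply] at this ⊢
    exact this.symm
  choose c hc using hdvd
  refine ⟨∑ j, b' j • g' j ^ q, Submodule.mem_coordPow_iff.2 ⟨m, b', g', fun j => ?_, rfl⟩, c, ?_⟩
  · rw [mem_syzygiesMod, ← Ideal.Quotient.eq_zero_iff_mem, RingHom.map_dotProduct]
    rw [show Ideal.Quotient.mk (Ideal.span {x}) ∘ g' j = g j from funext (hg' j)]
    exact mem_syzygiesMod.1 (hg j)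
  · ext i
    rw [Pi.add_apply, Pi.smul_apply, smul_eq_mul, ← hc i]
    ring

theorem syzygiesMod_pow_le_coordPow [IsDomain R] (hx : x ≠ 0)
    (hR : PowSyzygiesGenerated (R ⧸ Ideal.span {x}) (p ^ n)) {k : ℕ} (f : Fin k → R) :
    syzygiesMod (f ^ p ^ n) (Ideal.span {x ^ p ^ n}) ≤
      (syzygiesMod f (Ideal.span {x})).coordPow (p ^ n) := by
  intro a ha
  have hq : p ^ n ≠ 0 := pow_ne_zero _ (Fact.out : p.Prime).ne_zero
  have key : ∀ j ≤ p ^ n, ∃ l ∈ (syzygiesMod f (Ideal.span {x})).coordPow (p ^ n),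
      ∃ a', a = l + x ^ j • a' := by
    intro j
    induction j with
    | zero => exact fun _ => ⟨0, zero_mem _, a, by simp⟩
    | succ j ih =>
      intro hj
      obtain ⟨l, hl, a', rfl⟩ := ih (by omega)
      have h1 : f ^ p ^ n ⬝ᵥ (x ^ j • a') ∈ Ideal.span {x ^ p ^ n} := by
        have := mem_syzygiesMod.1 ha
        rw [dotProduct_add] at this
        exact (Ideal.add_mem_iff_right _ (dotProduct_mem_of_mem_coordPow hl)).1 this
      have h2 : f ^ p ^ n ⬝ᵥ a' ∈ Ideal.span {x} := by
        rw [dotProduct_smul, smul_eq_mul, Ideal.mem_span_singleton] at h1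
        rw [Ideal.mem_span_singleton]
        refine (mul_dvd_mul_iff_left (pow_ne_zero j hx)).1 ?_
        rw [← pow_succ]
        exact (pow_dvd_pow x hj).trans h1
      obtain ⟨l', hl', a'', rfl⟩ := exists_mem_coordPow_add_smul hR h2
      exact ⟨l + x ^ j • l', add_mem hl (Submodule.smul_mem _ _ hl'), a'', by
        rw [smul_add, smul_smul, pow_succ, add_assoc]⟩
  obtain ⟨l, hl, a', rfl⟩ := key _ le_rfl
  refine add_mem hl (pow_smul_mem_coordPow (fun b => ?_) hq a')
  rw [mem_syzygiesMod, dotProduct_smul]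
  exact Ideal.mem_span_singleton.2 (dvd_mul_right _ _)

theorem syzygiesMod_pow_pow_le_coordPow [IsDomain R] (hx : x ≠ 0)
    (hR : PowSyzygiesGenerated (R ⧸ Ideal.span {x}) (p ^ n)) {k : ℕ} (f : Fin k → R) (N : ℕ) :
    syzygiesMod (f ^ p ^ n) (Ideal.span {(x ^ N) ^ p ^ n}) ≤
      (syzygiesMod f (Ideal.span {x ^ N})).coordPow (p ^ n) := by
  have hq : p ^ n ≠ 0 := pow_ne_zero _ (Fact.out : p.Prime).ne_zero
  induction N with
  | zero =>
    intro a _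
    have := pow_smul_mem_coordPow (N := syzygiesMod f (Ideal.span {x ^ 0})) (x := 1)
      (by simp [mem_syzygiesMod]) hq a
    rwa [one_pow, one_smul] at this
  | succ N ih =>
    intro a ha
    have haN : a ∈ syzygiesMod (f ^ p ^ n) (Ideal.span {(x ^ N) ^ p ^ n}) :=
      mem_syzygiesMod.2 (Ideal.span_singleton_le_span_singleton.2
        (pow_dvd_pow_of_dvd (pow_dvd_pow x N.le_succ) _) (mem_syzygiesMod.1 ha))
    obtain ⟨m, b, g, hg, rfl⟩ := Submodule.mem_coordPow_iff.1 (ih haN)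
    choose h hh using fun j => Ideal.mem_span_singleton.1 (mem_syzygiesMod.1 (hg j))
    have hb : b ∈ syzygiesMod (h ^ p ^ n) (Ideal.span {x ^ p ^ n}) := by
      rw [mem_syzygiesMod, Ideal.mem_span_singleton] at ha ⊢
      refine (mul_dvd_mul_iff_left (pow_ne_zero (p ^ n) (pow_ne_zero N hx))).1 ?_
      rw [← mul_pow, ← pow_succ]
      convert ha using 1
      rw [dotProduct_sum, dotProduct, Finset.mul_sum]
      refine Finset.sum_congr rfl fun j _ => ?_
      rw [dotProduct_smul, pow_dotProduct_pow_charP, hh, mul_pow, smul_eq_mul, Pi.pow_apply]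
      ring
    obtain ⟨m', c, e, he, rfl⟩ := Submodule.mem_coordPow_iff.1
      (syzygiesMod_pow_le_coordPow hx hR h hb)
    refine Submodule.mem_coordPow_iff.2 ⟨m', c, fun l => ∑ j, e l j • g j, fun l => ?_, ?_⟩
    · rw [mem_syzygiesMod, dotProduct_sum, Ideal.mem_span_singleton, pow_succ]
      have := Ideal.mem_span_singleton.1 (mem_syzygiesMod.1 (he l))
      convert mul_dvd_mul_left (x ^ N) this using 1
      rw [dotProduct, Finset.mul_sum]
      refine Finset.sum_congr rfl fun j _ => ?_
      rw [dotProduct_smul, hh, smul_eq_mul]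
      ring
    · ext i
      simp only [Finset.sum_apply, Pi.smul_apply, Pi.pow_apply, smul_eq_mul, sum_pow_char_pow,
        mul_pow, Finset.mul_sum, Finset.sum_mul]
      rw [Finset.sum_comm]
      simp only [mul_assoc]

theorem PowSyzygiesGenerated.of_quotient [IsDomain R] [IsNoetherianRing R] [IsLocalRing R]
    (hx : x ≠ 0) (hxm : x ∈ maximalIdeal R)
    (hR : PowSyzygiesGenerated (R ⧸ Ideal.span {x}) (p ^ n)) :
    PowSyzygiesGenerated R (p ^ n) := by
  intro k f a ha
  have hq : p ^ n ≠ 0 := pow_ne_zero _ (Fact.out : p.Prime).ne_zero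
  set K := (syzygiesMod f ⊥).coordPow (p ^ n) with hK
  have hxt : Ideal.span {x} ≠ ⊤ := by rwa [Ne, Ideal.span_singleton_eq_top]
  obtain ⟨c, hc⟩ := Ideal.exists_pow_inf_eq_pow_smul (Ideal.span {x})
    (LinearMap.range (dotProductBilin R R f : (Fin k → R) →ₗ[R] R))
  have hAR : ∀ M, ∀ g ∈ syzygiesMod f (Ideal.span {x ^ (M + c)}),
      ∃ g₀ ∈ syzygiesMod f ⊥, ∃ w, g = g₀ + x ^ M • w := by
    intro M g hg
    have h1 : f ⬝ᵥ g ∈ ((Ideal.span {x}) ^ (M + c) • ⊤ ⊓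
        LinearMap.range (dotProductBilin R R f : (Fin k → R) →ₗ[R] R) : Submodule R R) := by
      refine ⟨?_, g, rfl⟩
      rw [smul_eq_mul, Ideal.mul_top, Ideal.span_singleton_pow]
      exact mem_syzygiesMod.1 hg
    rw [hc _ (by omega), Nat.add_sub_cancel, Ideal.span_singleton_pow,
      Submodule.ideal_span_singleton_smul] at h1
    obtain ⟨_, ⟨-, w, rfl⟩, hw⟩ := h1
    refine ⟨g - x ^ M • w, ?_, w, by simp⟩
    rw [mem_syzygiesMod, Ideal.mem_bot, dotProduct_sub, dotProduct_smul, sub_eq_zero]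
    exact hw.symm
  have hKrull : ∀ M, Submodule.Quotient.mk (p := K) a ∈
      ((Ideal.span {x}) ^ M • ⊤ : Submodule R ((Fin k → R) ⧸ K)) := by
    intro M
    have haM : a ∈ syzygiesMod (f ^ p ^ n) (Ideal.span {(x ^ (M + c)) ^ p ^ n}) :=
      Submodule.comap_mono bot_le ha
    replace haM := syzygiesMod_pow_pow_le_coordPow hx hR f (M + c) haM
    suffices h : (syzygiesMod f (Ideal.span {x ^ (M + c)})).coordPow (p ^ n) ≤
        ((Ideal.span {x}) ^ M • ⊤ : Submodule R ((Fin k → R) ⧸ K)).comap K.mkQ from h haM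
    refine Submodule.span_le.2 ?_
    rintro _ ⟨g, hg, rfl⟩
    obtain ⟨g₀, hg₀, w, rfl⟩ := hAR M g hg
    have hpow : (g₀ + x ^ M • w) ^ p ^ n = g₀ ^ p ^ n + x ^ M • (x ^ (M * (p ^ n - 1)) • w ^ p ^ n) := by
      ext i
      simp only [Pi.pow_apply, Pi.add_apply, Pi.smul_apply, smul_eq_mul, add_pow_char_pow, mul_pow]
      rw [← mul_assoc, ← pow_add, ← pow_mul]
      congr 3
      obtain ⟨r, hr⟩ := Nat.exists_eq_succ_of_ne_zero hq
      rw [hr]; simp; ring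
    simp only [SetLike.mem_coe, Submodule.mem_comap, hpow, map_add]
    rw [Submodule.mkQ_apply, (Submodule.Quotient.mk_eq_zero K).2
      (Submodule.pow_mem_coordPow hg₀ _), zero_add, map_smul]
    exact Submodule.smul_mem_smul (Ideal.pow_mem_pow (Ideal.mem_span_singleton_self x) M)
      Submodule.mem_top
  rw [← Submodule.Quotient.mk_eq_zero K, ← Submodule.mem_bot R,
    ← Ideal.iInf_pow_smul_eq_bot_of_isLocalRing (M := (Fin k → R) ⧸ K) (Ideal.span {x}) hxt]
  exact (Submodule.mem_iInf _).2 hKrull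

end Quotient

theorem PowSyzygiesGenerated.of_isField (hR : IsField R) : PowSyzygiesGenerated R (p ^ n) := by
  let := hR.toField
  have hq : p ^ n ≠ 0 := pow_ne_zero _ (Fact.out : p.Prime).ne_zero
  intro k f a ha
  rw [mem_syzygiesMod, Ideal.mem_bot] at ha
  by_cases hf : f = 0
  · subst hf
    simpa using pow_smul_mem_coordPow (N := syzygiesMod (0 : Fin k → R) ⊥) (x := 1)
      (by simp [mem_syzygiesMod]) hq a
  obtain ⟨i₀, hi₀⟩ := Function.ne_iff.1 hf
  rw [Pi.zero_apply] at hi₀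
  refine Submodule.mem_coordPow_iff.2 ⟨k, a,
    fun i => Pi.single i 1 - Pi.single i₀ (f i / f i₀), fun i => ?_, ?_⟩
  · rw [mem_syzygiesMod, Ideal.mem_bot, dotProduct_sub, dotProduct_single, dotProduct_single]
    field_simp
    simp
  · have hsingle : ∀ (i : Fin k) (r : R),
        (Pi.single i r : Fin k → R) ^ p ^ n = Pi.single i (r ^ p ^ n) := by
      intro i r
      ext j
      by_cases h : j = i
      · subst h; simp
      · simp [h, zero_pow hq]
    have hsub : ∀ u v : Fin k → R, (u - v) ^ p ^ n = u ^ p ^ n - v ^ p ^ n := by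
      intro u v
      ext j
      exact sub_pow_char_pow ..
    simp only [hsub, hsingle, one_pow, smul_sub, Finset.sum_sub_distrib]
    rw [← pi_eq_sum_univ' a, sub_eq_self]
    have : ∑ i, a i * (f i / f i₀) ^ p ^ n = 0 := by
      simp only [div_pow, mul_div_assoc', ← Finset.sum_div]
      rw [div_eq_zero_iff]
      left
      rw [← ha, dotProduct]
      exact Finset.sum_congr rfl fun _ _ => mul_comm _ _
    ext j
    by_cases h : j = i₀
    · subst h; simpa using this
    · simp [h]

theorem Ideal.mem_bracketPow_colon_of_pow_mul_mem {R : Type u} [CommRing R] {q : ℕ}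
    (hR : PowSyzygiesGenerated R q) {I : Ideal R} {t s : R} (h : t ^ q * s ∈ Ideal.bracketPow I q) :
    s ∈ Ideal.bracketPow (Submodule.colon I {t}) q := by
  obtain ⟨m, c, y, hy⟩ := Submodule.mem_span_set'.1 h
  choose z hz hzy using fun j => (y j).2
  have hrel : (Fin.cons s (-c) : Fin (m + 1) → R) ∈
      syzygiesMod ((Fin.cons t z : Fin (m + 1) → R) ^ q) ⊥ := by
    rw [mem_syzygiesMod, Ideal.mem_bot, dotProduct, Fin.sum_univ_succ]
    simp only [Pi.pow_apply, Fin.cons_zero, Fin.cons_succ, Pi.neg_apply, mul_neg,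
      Finset.sum_neg_distrib]
    rw [← hy, add_neg_eq_zero]
    exact Finset.sum_congr rfl fun j _ => by rw [← hzy j, smul_eq_mul, mul_comm]
  obtain ⟨l, b, g, hg, hsum⟩ := Submodule.mem_coordPow_iff.1 (hR _ _ hrel)
  have hs := congrFun hsum 0
  simp only [Finset.sum_apply, Pi.smul_apply, Pi.pow_apply, smul_eq_mul, Fin.cons_zero] at hs
  rw [← hs]
  refine _root_.sum_mem fun i _ => Ideal.mul_mem_left _ _ (Submodule.subset_span ?_)
  refine ⟨g i 0, ?_, rfl⟩
  have hgi := mem_syzygiesMod.1 (hg i)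
  rw [Ideal.mem_bot, dotProduct, Fin.sum_univ_succ] at hgi
  simp only [Fin.cons_zero, Fin.cons_succ] at hgi
  rw [SetLike.mem_coe, Submodule.mem_colon_singleton, smul_eq_mul, mul_comm,
    eq_neg_of_add_eq_zero_left hgi]
  exact neg_mem (_root_.sum_mem fun j _ => Ideal.mul_mem_right _ _ (hz j))

theorem PowSyzygiesGenerated.of_ofList_eq_maximalIdeal {R : Type u} [CommRing R]
    [IsNoetherianRing R] [IsLocalRing R] {p : ℕ} [Fact p.Prime] [CharP R p] (n : ℕ) (xs : List R)
    (h : Ideal.ofList xs = maximalIdeal R) (hdim : (xs.length : WithBot ℕ∞) ≤ ringKrullDim R) :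
    PowSyzygiesGenerated R (p ^ n) := by
  induction hd : xs.length generalizing R xs with
  | zero =>
    obtain rfl := List.length_eq_zero_iff.1 hd
    rw [Ideal.ofList_nil] at h
    exact .of_isField (isField_iff_maximalIdeal_eq.2 h.symm)
  | succ d ih =>
    have := isDomain_of_ofList_eq_maximalIdeal xs h hdim
    obtain ⟨x, xs, rfl⟩ := List.exists_cons_of_length_eq_add_one hd
    have hx := mem_maximalIdeal_of_ofList_cons h
    have hne : Ideal.span {x} ≠ ⊤ := by
      rwa [Ne, Ideal.span_singleton_eq_top]
    have : Nontrivial (R ⧸ Ideal.span {x}) := Ideal.Quotient.nontrivial_iff.2 hne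
    have : IsLocalRing (R ⧸ Ideal.span {x}) :=
      .of_surjective' _ Ideal.Quotient.mk_surjective
    have : CharP (R ⧸ Ideal.span {x}) p := by
      rw [CharP.charP_iff_prime_eq_zero Fact.out, ← map_natCast (Ideal.Quotient.mk _),
        CharP.cast_eq_zero, map_zero]
    have hm := Ideal.ofList_map_quotient_mk_eq_maximalIdeal h
    have hle := length_le_ringKrullDim_quotient h hdim
    have hx0 : x ≠ 0 := by
      rintro rfl
      have h1 := ringKrullDim_le_length_of_ofList_eq_maximalIdeal (R := R) (xs := xs) (by
        rw [← h, Ideal.ofList_cons]; simp)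
      have h2 := hdim.trans h1
      rw [List.length_cons] at h2
      norm_cast at h2
      omega
    exact .of_quotient hx0 hx (ih _ hm (by simpa using hle) (by simpa using hd))

theorem IsRegularLocal.powSyzygiesGenerated {R : Type u} [CommRing R]
    [IsNoetherianRing R] [IsLocalRing R] {p : ℕ} [Fact p.Prime] [CharP R p]
    (h : IsRegularLocal R) (n : ℕ) : PowSyzygiesGenerated R (p ^ n) := by
  obtain ⟨s, hcard, hspan⟩ := h
  refine .of_ofList_eq_maximalIdeal n s.toList ?_ ?_
  · rw [← hspan, Ideal.ofList]
    exact congrArg Ideal.span (Set.ext fun _ => Finset.mem_toList)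
  · rw [Finset.length_toList]
    exact hcard.le

end FrobeniusSyzygies

theorem bracket_pow_colon_le_of_associated_prime (S : Type u) [CommRing S] [IsNoetherianRing S] [IsLocalRing S]
    (p : ℕ) [Fact p.Prime] [CharP S p] (hreg : IsRegularLocal S)
    (𝔄 : Ideal S) (h0 : 𝔄 ≠ ⊥) (h1 : 𝔄 ≠ ⊤) (n : ℕ) (hn : 1 ≤ n)
    (𝔓 : Ideal S) (h𝔓 : 𝔓 ∈ associatedPrimes S (S ⧸ 𝔄)) :
    Submodule.colon (Ideal.bracketPow 𝔄 (p ^ n)) 𝔄 ≤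
      Submodule.colon (Ideal.bracketPow 𝔓 (p ^ n)) 𝔓 := by
  obtain ⟨-, x, rfl⟩ := isAssociatedPrime_iff.1 h𝔓
  obtain ⟨t, rfl⟩ := Ideal.Quotient.mk_surjective x
  have hcolon : Submodule.colon (⊥ : Submodule S (S ⧸ 𝔄)) {Ideal.Quotient.mk 𝔄 t} =
      Submodule.colon 𝔄 {t} := by
    ext r
    rw [Submodule.mem_colon_singleton, Submodule.mem_colon_singleton, Submodule.mem_bot,
      ← Ideal.Quotient.eq_zero_iff_mem]
    rfl
  rw [hcolon]
  intro u hu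
  refine Submodule.mem_colon.2 fun r hr => ?_
  refine Ideal.mem_bracketPow_colon_of_pow_mul_mem (hreg.powSyzygiesGenerated n) ?_
  have h := Submodule.mem_colon.1 hu _ (Submodule.mem_colon_singleton.1 hr)
  obtain ⟨k, hk⟩ := Nat.exists_eq_succ_of_ne_zero
    (pow_ne_zero n (Fact.out : p.Prime).ne_zero : p ^ n ≠ 0)
  have heq : t ^ p ^ n * u • r = t ^ k * u • r • t := by
    rw [hk, pow_succ]
    simp only [smul_eq_mul]
    ring
  rw [heq]
  exact Ideal.mul_mem_left _ _ h
end

section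
/- Let S be a regular local ring of characteristic p, let 𝔄 be an ideal of S with 0 ≠ 𝔄 ≠ S, let 𝔄 = 𝔔₁ ∩ ⋯ ∩ 𝔔_t be a minimal primary decomposition of 𝔄, and let n ≥ 1, q = p^n. Then (𝔄^{[q]} : 𝔄) ≠ S. Moreover, if 𝔓₁ = √𝔔₁ is a minimal prime of 𝔄, then 𝔓₁ is a minimal prime of (𝔄^{[q]} : 𝔄), and the unique 𝔓₁-primary component of (𝔄^{[q]} : 𝔄) — namely the contraction to S of the extension of (𝔄^{[q]} : 𝔄) to the localization S_{𝔓₁} — equals (𝔔₁^{[q]} : 𝔔₁). -/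
open TensorProduct IsLocalRing DirectSum

universe u v

section

open RingTheory.Sequence Function
open scoped Pointwise

section
variable {R : Type u} [CommRing R]

theorem weaklyRegular_and_length_of_exact (rs : List R) :
    ∀ {A B C : Type v} [AddCommGroup A] [AddCommGroup B] [AddCommGroup C]
    [Module R A] [Module R B] [Module R C] (f : A →ₗ[R] B) (g : B →ₗ[R] C)
    (_ : Injective f) (_ : Exact f g) (_ : Surjective g)
    (_ : IsWeaklyRegular A rs) (_ : IsWeaklyRegular C rs),
    IsWeaklyRegular B rs ∧
      Module.length R (B ⧸ (Ideal.ofList rs • ⊤ : Submodule R B)) =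
        Module.length R (A ⧸ (Ideal.ofList rs • ⊤ : Submodule R A)) +
        Module.length R (C ⧸ (Ideal.ofList rs • ⊤ : Submodule R C)) := by
  induction rs with
  | nil =>
    intro A B C _ _ _ _ _ _ f g hf hfg hg _ _
    have h (M : Type v) [AddCommGroup M] [Module R M] :
        Module.length R (M ⧸ (Ideal.ofList ([] : List R) • ⊤ : Submodule R M)) =
          Module.length R M :=
      (Submodule.quotEquivOfEqBot _ (by simp)).length_eq
    exact ⟨.nil R B, by rw [h, h, h, Module.length_eq_add_of_exact f g hf hg hfg]⟩
  | cons r rs ih =>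
    intro A B C _ _ _ _ _ _ f g hf hfg hg hA hC
    rw [isWeaklyRegular_cons_iff] at hA hC ⊢
    have hinj : Injective (QuotSMulTop.map r f) := by
      have h0 : Exact (0 : PUnit.{v + 1} →ₗ[R] A) f := by
        intro x
        rw [map_eq_zero_iff f hf]
        exact ⟨fun h => ⟨0, h.symm⟩, fun ⟨_, h⟩ => h.symm⟩
      have := QuotSMulTop.map_first_exact_on_four_term_exact_of_isSMulRegular_last
        h0 hfg hC.1
      rw [injective_iff_map_eq_zero]
      intro x hx
      obtain ⟨y, rfl⟩ := (this x).mp hx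
      simp
    obtain ⟨h1, h2⟩ := ih (QuotSMulTop.map r f) (QuotSMulTop.map r g) hinj
      (QuotSMulTop.map_exact r hfg hg) (QuotSMulTop.map_surjective r hg) hA.2 hC.2
    refine ⟨⟨isSMulRegular_of_range_eq_ker hf hfg.linearMap_ker_eq.symm hA.1 hC.1, h1⟩, ?_⟩
    have e (M : Type v) [AddCommGroup M] [Module R M] :=
      (Submodule.quotOfListConsSMulTopEquivQuotSMulTopInner M r rs).length_eq
    rw [e, e, e, h2]

theorem weaklyRegular_pow_and_length (a : ℕ) (ha : a ≠ 0) (rs : List R) :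
    ∀ {M : Type v} [AddCommGroup M] [Module R M] (_ : IsWeaklyRegular M rs),
    IsWeaklyRegular M (rs.map (· ^ a)) ∧
      Module.length R (M ⧸ (Ideal.ofList (rs.map (· ^ a)) • ⊤ : Submodule R M)) =
        a ^ rs.length * Module.length R (M ⧸ (Ideal.ofList rs • ⊤ : Submodule R M)) := by
  induction rs with
  | nil => intro M _ _ h; exact ⟨h, by simp; rfl⟩
  | cons r rs ih =>
    intro M _ _ h
    rw [isWeaklyRegular_cons_iff] at h
    obtain ⟨h1, h2⟩ := ih h.2
    set L := rs.map (· ^ a) with hL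
    have key (j : ℕ) : IsWeaklyRegular (QuotSMulTop (r ^ (j + 1)) M) L ∧
        Module.length R (QuotSMulTop (r ^ (j + 1)) M ⧸
          (Ideal.ofList L • ⊤ : Submodule R (QuotSMulTop (r ^ (j + 1)) M))) =
        (j + 1 : ℕ) * Module.length R (QuotSMulTop r M ⧸
          (Ideal.ofList L • ⊤ : Submodule R (QuotSMulTop r M))) := by
      induction j with
      | zero => rw [zero_add, pow_one]; exact ⟨h1, by simp⟩
      | succ j ihj =>
        let f : QuotSMulTop r M →ₗ[R] QuotSMulTop (r ^ (j + 2)) M :=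
          Submodule.mapQ _ _ (LinearMap.lsmul R M (r ^ (j + 1))) (by
            rintro _ ⟨x, -, rfl⟩
            exact ⟨x, trivial, by simp [pow_succ, smul_smul, mul_comm]⟩)
        let g : QuotSMulTop (r ^ (j + 2)) M →ₗ[R] QuotSMulTop (r ^ (j + 1)) M :=
          Submodule.factor (by
            rintro _ ⟨x, -, rfl⟩
            exact ⟨r • x, trivial, by simp [pow_succ, smul_smul, mul_comm]⟩)
        have hf : Injective f := by
          rw [injective_iff_map_eq_zero]
          intro x hx
          obtain ⟨x, rfl⟩ := Submodule.mkQ_surjective _ x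
          have hx' : r ^ (j + 1) • x ∈ r ^ (j + 2) • (⊤ : Submodule R M) :=
            (Submodule.Quotient.mk_eq_zero _).mp hx
          obtain ⟨y, -, hy⟩ := hx'
          refine (Submodule.Quotient.mk_eq_zero _).mpr ⟨y, trivial, ?_⟩
          apply h.1.pow (j + 1)
          simpa [pow_succ, smul_smul, mul_comm, mul_left_comm] using hy
        have hg : Surjective g := Submodule.factor_surjective _
        have hfg : Exact f g := by
          intro x
          obtain ⟨x, rfl⟩ := Submodule.mkQ_surjective _ x
          constructor
          · intro hx
            have hx' : x ∈ r ^ (j + 1) • (⊤ : Submodule R M) :=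
              (Submodule.Quotient.mk_eq_zero _).mp hx
            obtain ⟨y, -, rfl⟩ := hx'
            exact ⟨Submodule.mkQ _ y, rfl⟩
          · rintro ⟨y, hy⟩
            obtain ⟨y, rfl⟩ := Submodule.mkQ_surjective _ y
            rw [← hy]
            exact (Submodule.Quotient.mk_eq_zero _).mpr ⟨y, trivial, rfl⟩
        obtain ⟨h3, h4⟩ := weaklyRegular_and_length_of_exact L f g hf hfg hg h1 ihj.1
        refine ⟨h3, h4.trans ?_⟩
        rw [ihj.2]
        push_cast
        ring
    obtain ⟨b, rfl⟩ := Nat.exists_eq_succ_of_ne_zero ha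
    refine ⟨?_, ?_⟩
    · rw [List.map_cons, isWeaklyRegular_cons_iff]
      exact ⟨h.1.pow _, (key b).1⟩
    · rw [List.map_cons,
        (Submodule.quotOfListConsSMulTopEquivQuotSMulTopInner M _ _).length_eq,
        (Submodule.quotOfListConsSMulTopEquivQuotSMulTopInner M _ _).length_eq, (key b).2, h2,
        List.length_cons, pow_succ, Nat.succ_eq_add_one]
      ring
end

section

theorem natCast_le_of_natCast_add_one_le_add_one {a : WithBot ℕ∞} {d : ℕ}
    (h : ((d + 1 : ℕ) : WithBot ℕ∞) ≤ a + 1) : (d : WithBot ℕ∞) ≤ a := by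
  induction a with
  | bot => simp at h
  | coe a =>
    have : ((d + 1 : ℕ) : ℕ∞) ≤ a + 1 := by exact_mod_cast h
    push_cast at this
    exact_mod_cast (ENat.add_le_add_iff_right ENat.one_ne_top).mp this

variable {S : Type u} [CommRing S]

theorem exists_span_insert_erase_eq_maximalIdeal [IsLocalRing S] [DecidableEq S] {s : Finset S}
    (hs : Ideal.span (s : Set S) = maximalIdeal S) {x : S} (hx : x ∈ maximalIdeal S)
    (hx2 : x ∉ maximalIdeal S ^ 2) :
    ∃ y ∈ s, Ideal.span (insert x (s.erase y : Finset S) : Set S) = maximalIdeal S := by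
  rw [← hs] at hx
  obtain ⟨f, -, hf⟩ := Submodule.mem_span_finset.mp hx
  obtain ⟨y, hy, hfy⟩ : ∃ y ∈ s, f y ∉ maximalIdeal S := by
    by_contra! h
    refine hx2 (hf ▸ Ideal.sum_mem _ fun a ha => ?_)
    rw [pow_two]
    exact Ideal.mul_mem_mul (h a ha) (hs ▸ Ideal.subset_span ha)
  refine ⟨y, hy, le_antisymm ?_ ?_⟩
  · rw [Ideal.span_le, Set.insert_subset_iff, ← hs]
    exact ⟨hx, fun z hz => Ideal.subset_span (Finset.mem_of_mem_erase hz)⟩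
  · rw [← hs, Ideal.span_le]
    intro z hz
    by_cases hzy : z = y
    · subst hzy
      have hu : IsUnit (f z) := by simpa using hfy
      refine (Ideal.unit_mul_mem_iff_mem _ hu).mp ?_
      rw [← Finset.add_sum_erase s _ hy] at hf
      rw [← smul_eq_mul, eq_sub_of_add_eq hf]
      refine sub_mem (Ideal.subset_span (Set.mem_insert _ _)) (Ideal.sum_mem _ fun a ha => ?_)
      exact Ideal.mul_mem_left _ _ (Ideal.subset_span (Set.mem_insert_of_mem _ ha))
    · exact Ideal.subset_span (Set.mem_insert_of_mem _ (Finset.mem_erase.mpr ⟨hzy, hz⟩))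

theorem ringKrullDim_le_ringKrullDim_quotient_span_singleton_add_one [IsNoetherianRing S]
    [IsLocalRing S] {x : S} (hx : x ∈ maximalIdeal S) :
    ringKrullDim S ≤ ringKrullDim (S ⧸ Ideal.span {x}) + 1 := by
  rw [← maximalIdeal_height_eq_ringKrullDim]
  exact Ideal.height_le_ringKrullDim_quotient_add_one hx

theorem ringKrullDim_le_card_of_span_eq_maximalIdeal [IsNoetherianRing S]
    [IsLocalRing S] {s : Finset S} (hs : Ideal.span (s : Set S) = maximalIdeal S) :
    ringKrullDim S ≤ s.card := by
  rw [← maximalIdeal_height_eq_ringKrullDim]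
  exact WithBot.coe_le_coe.mpr (Ideal.height_le_card_of_mem_minimalPrimes_span_finset (by
    rw [hs, Ideal.minimalPrimes_eq_subsingleton_self]; rfl))

theorem exists_mem_maximalIdeal_notMem_sq_notMem_minimalPrimes [IsNoetherianRing S]
    [IsLocalRing S] (h : 0 < ringKrullDim S) :
    ∃ x ∈ maximalIdeal S, x ∉ maximalIdeal S ^ 2 ∧ ∀ P ∈ minimalPrimes S, x ∉ P := by
  classical
  by_contra! H
  have hfin := minimalPrimes.finite_of_isNoetherianRing S
  have hsub : (maximalIdeal S : Set S) ⊆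
      ⋃ i ∈ ((insert (maximalIdeal S ^ 2) hfin.toFinset : Finset (Ideal S)) : Set (Ideal S)),
        (id i : Ideal S) := by
    intro x hx
    simp only [Finset.coe_insert, Set.mem_iUnion]
    by_cases hx2 : x ∈ maximalIdeal S ^ 2
    · exact ⟨_, Set.mem_insert _ _, hx2⟩
    · obtain ⟨P, hP, hxP⟩ := H x hx hx2
      exact ⟨P, Set.mem_insert_of_mem _ (by simpa using hP), hxP⟩
  rw [Ideal.subset_union_prime (maximalIdeal S ^ 2) (maximalIdeal S ^ 2)] at hsub
  · obtain ⟨P, hP, hle⟩ := hsub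
    rw [← maximalIdeal_height_eq_ringKrullDim] at h
    rw [Finset.mem_insert, Set.Finite.mem_toFinset] at hP
    obtain rfl | hP := hP
    · have hbot : maximalIdeal S = ⊥ :=
        Submodule.eq_bot_of_le_smul_of_le_jacobson_bot _ _ (IsNoetherian.noetherian _)
          (by simpa [pow_two] using hle) (maximalIdeal_le_jacobson _)
      have h1 : (maximalIdeal S).height = 0 := by
        rw [Ideal.height_eq_zero_iff]
        exact ⟨⟨inferInstance, bot_le⟩, fun _ _ _ => hbot ▸ bot_le⟩
      simp [h1] at h
    · have hPm : P = maximalIdeal S :=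
        le_antisymm (le_maximalIdeal hP.1.1.ne_top) hle
      subst hPm
      rw [Ideal.height_eq_zero_iff.mpr hP] at h
      simp at h
  · intro i hi hi1 _
    rw [Finset.mem_insert, Set.Finite.mem_toFinset] at hi
    exact (hi.resolve_left hi1).1.1

theorem isDomain_of_span_eq_maximalIdeal (d : ℕ) :
    ∀ {S : Type u} [CommRing S] [IsNoetherianRing S] [IsLocalRing S] {s : Finset S},
      Ideal.span (s : Set S) = maximalIdeal S → s.card ≤ d → (d : WithBot ℕ∞) ≤ ringKrullDim S →
        IsDomain S := by
  classical
  induction d with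
  | zero =>
    intro S _ _ _ s hs hd _
    obtain rfl : s = ∅ := by simpa using hd
    have : IsField S := by
      rw [isField_iff_maximalIdeal_eq, ← hs]
      simp
    exact this.isDomain
  | succ d ih =>
    intro S _ _ _ s hs hd hdim
    obtain ⟨x, hx, hx2, hxP⟩ := exists_mem_maximalIdeal_notMem_sq_notMem_minimalPrimes
      (lt_of_lt_of_le (by exact_mod_cast Nat.succ_pos d) hdim)
    obtain ⟨y, hy, hspan⟩ := exists_span_insert_erase_eq_maximalIdeal hs hx hx2
    let π := Ideal.Quotient.mk (Ideal.span {x})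
    have : Nontrivial (S ⧸ Ideal.span {x}) :=
      Ideal.Quotient.nontrivial_iff.mpr
        (ne_top_of_le_ne_top Ideal.IsPrime.ne_top' ((Ideal.span_singleton_le_iff_mem _).mpr hx))
    have := IsLocalRing.of_surjective' π Ideal.Quotient.mk_surjective
    have hspan' : Ideal.span (((s.erase y).image π : Finset _) : Set (S ⧸ Ideal.span {x})) =
        maximalIdeal (S ⧸ Ideal.span {x}) := by
      rw [← map_maximalIdeal_of_surjective π Ideal.Quotient.mk_surjective, ← hspan, Ideal.map_span,
        Set.image_insert_eq, Finset.coe_image, Ideal.span_insert]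
      simp [π]
    have hdom := ih hspan' (Finset.card_image_le.trans (by
        rw [Finset.card_erase_of_mem hy]; omega)) (natCast_le_of_natCast_add_one_le_add_one
      (hdim.trans (ringKrullDim_le_ringKrullDim_quotient_span_singleton_add_one hx)))
    have hprime : (Ideal.span {x}).IsPrime := (Ideal.Quotient.isDomain_iff_prime _).mp hdom
    obtain ⟨P, hP, hPx⟩ := Ideal.exists_minimalPrimes_le (bot_le : (⊥ : Ideal S) ≤ Ideal.span {x})
    have hPp : P.IsPrime := hP.1.1
    have hbot : P = ⊥ := by
      refine Submodule.eq_bot_of_le_smul_of_le_jacobson_bot (maximalIdeal S) _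
        (IsNoetherian.noetherian _) (fun z hz => ?_) (maximalIdeal_le_jacobson _)
      obtain ⟨w, rfl⟩ := Ideal.mem_span_singleton'.mp (hPx hz)
      rw [mul_comm]
      exact Ideal.mul_mem_mul hx ((hPp.mem_or_mem hz).resolve_right (hxP P hP))
    rw [hbot] at hPp
    exact IsDomain.of_bot_isPrime S

theorem isWeaklyRegular_of_ofList_eq_maximalIdeal (n : ℕ) :
    ∀ {S : Type u} [CommRing S] [IsNoetherianRing S] [IsLocalRing S] {rs : List S},
      rs.length = n → Ideal.ofList rs = maximalIdeal S → (n : WithBot ℕ∞) ≤ ringKrullDim S →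
        IsWeaklyRegular S rs := by
  classical
  have hfin {S : Type u} [CommRing S] (rs : List S) :
      Ideal.span (rs.toFinset : Set S) = Ideal.ofList rs := by simp [Ideal.ofList]
  induction n with
  | zero =>
    intro S _ _ _ rs hn _ _
    rw [List.length_eq_zero_iff.mp hn]
    exact .nil S S
  | succ n ih =>
    rintro S _ _ _ (_ | ⟨r, rs⟩) hn hrs hdim
    · simp at hn
    have hr : r ∈ maximalIdeal S := hrs ▸ Ideal.subset_span (List.mem_cons_self ..)
    have hdom : IsDomain S := isDomain_of_span_eq_maximalIdeal (n + 1) ((hfin _).trans hrs)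
      ((List.toFinset_card_le _).trans hn.le) hdim
    have hr0 : r ≠ 0 := by
      rintro rfl
      have h1 := ringKrullDim_le_card_of_span_eq_maximalIdeal ((hfin rs).trans (by
        rw [← hrs, Ideal.ofList_cons]; simp))
      have h2 := hdim.trans h1
      have h3 : n + 1 ≤ rs.toFinset.card := by exact_mod_cast h2
      have := rs.toFinset_card_le
      simp at hn
      omega
    refine .cons (IsSMulRegular.of_ne_zero hr0) ?_
    let π := Ideal.Quotient.mk (Ideal.span {r})
    have : Nontrivial (S ⧸ Ideal.span {r}) :=
      Ideal.Quotient.nontrivial_iff.mpr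
        (ne_top_of_le_ne_top Ideal.IsPrime.ne_top' ((Ideal.span_singleton_le_iff_mem _).mpr hr))
    have := IsLocalRing.of_surjective' π Ideal.Quotient.mk_surjective
    have h := ih (rs := rs.map (algebraMap S (S ⧸ Ideal.span {r}))) (by simpa using hn) (by
      rw [← map_maximalIdeal_of_surjective π Ideal.Quotient.mk_surjective, ← hrs,
        Ideal.map_ofList, List.map_cons, Ideal.ofList_cons]
      simp [π]) (natCast_le_of_natCast_add_one_le_add_one
      (hdim.trans (ringKrullDim_le_ringKrullDim_quotient_span_singleton_add_one hr)))
    rw [isWeaklyRegular_map_algebraMap_iff] at h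
    refine (LinearEquiv.isWeaklyRegular_congr (Submodule.quotEquivOfEq _ _ ?_) rs).mp h
    rw [← Submodule.ideal_span_singleton_smul, smul_eq_mul, Ideal.mul_top]
end

section
variable {S : Type u} [CommRing S]

theorem length_quotient_le_of_le {I J : Ideal S} (h : I ≤ J) :
    Module.length S (S ⧸ J) ≤ Module.length S (S ⧸ I) :=
  Module.length_le_of_surjective (Submodule.factor h) (Submodule.factor_surjective h)

theorem length_quotient_eq_colon_add_sup (I : Ideal S) (s : S) :
    Module.length S (S ⧸ I) = Module.length S (S ⧸ (I.colon {s} : Ideal S)) +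
      Module.length S (S ⧸ (I ⊔ Ideal.span {s})) := by
  let f : (S ⧸ (I.colon {s} : Ideal S)) →ₗ[S] (S ⧸ I) :=
    Submodule.mapQ _ _ (LinearMap.mulLeft S s) fun x hx => by
      simpa [Submodule.mem_colon_singleton, mul_comm] using hx
  refine Module.length_eq_add_of_exact f (Submodule.factor le_sup_left) ?_
    (Submodule.factor_surjective _) ?_
  · rw [← LinearMap.ker_eq_bot, Submodule.ker_mapQ]
    rw [eq_bot_iff, Submodule.map_le_iff_le_comap, Submodule.comap_bot, Submodule.ker_mkQ]
    intro x hx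
    simpa [Submodule.mem_colon_singleton, mul_comm] using hx
  · rw [LinearMap.exact_iff, Submodule.factor, Submodule.ker_mapQ, Submodule.range_mapQ,
      Submodule.comap_id, Submodule.map_sup]
    simp only [Submodule.mkQ_map_self, bot_sup_eq]
    congr 1
    ext x
    simp [Ideal.mem_span_singleton', mul_comm]

theorem eq_of_le_of_length_quotient_eq {I J : Ideal S} (h : I ≤ J)
    (hfin : Module.length S (S ⧸ I) ≠ ⊤)
    (heq : Module.length S (S ⧸ I) = Module.length S (S ⧸ J)) : I = J := by
  refine le_antisymm h fun u hu => ?_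
  have h1 := length_quotient_eq_colon_add_sup I u
  have h2 : Module.length S (S ⧸ J) ≤ Module.length S (S ⧸ (I ⊔ Ideal.span {u})) :=
    length_quotient_le_of_le (sup_le h ((Ideal.span_singleton_le_iff_mem _).mpr hu))
  have h3 : Module.length S (S ⧸ (I.colon {u} : Ideal S)) = 0 := by
    rw [← heq] at h2
    rw [h1] at h2 hfin
    generalize Module.length S (S ⧸ (I.colon {u} : Ideal S)) = a at *
    generalize Module.length S (S ⧸ (I ⊔ Ideal.span {u})) = b at *
    lift a to ℕ using by rintro rfl; simp at hfin
    lift b to ℕ using by rintro rfl; simp at hfin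
    norm_cast at *
    omega
  rw [Module.length_eq_zero_iff, Ideal.Quotient.subsingleton_iff, Ideal.eq_top_iff_one,
    Submodule.mem_colon_singleton] at h3
  simpa using h3

theorem length_quotient_map_add_le [IsNoetherianRing S] [IsLocalRing S] (φ : S →+* S)
    {J' : Ideal S} (J : Ideal S) (h : J ≤ J') (hk : ∃ k, maximalIdeal S ^ k * J' ≤ J) :
    Module.length S (S ⧸ J.map φ) +
        Module.length S (S ⧸ (maximalIdeal S).map φ) * Module.length S (S ⧸ J') ≤
      Module.length S (S ⧸ J'.map φ) +
        Module.length S (S ⧸ (maximalIdeal S).map φ) * Module.length S (S ⧸ J) := by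
  induction J using WellFoundedGT.induction with
  | ind J ih =>
  obtain rfl | hne := h.eq_or_lt
  · exact le_rfl
  classical
  obtain ⟨u, huJ', huJ, hu⟩ : ∃ u ∈ J', u ∉ J ∧ ∀ x ∈ maximalIdeal S, x * u ∈ J := by
    have hmin (m) (hm : m < Nat.find hk) : ¬ maximalIdeal S ^ m * J' ≤ J := Nat.find_min hk hm
    have hspec : maximalIdeal S ^ Nat.find hk * J' ≤ J := Nat.find_spec hk
    obtain hz | ⟨k, hk'⟩ : Nat.find hk = 0 ∨ ∃ k, Nat.find hk = k + 1 :=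
      (Nat.find hk).eq_zero_or_eq_succ_pred.imp_right fun h => ⟨_, h⟩
    · rw [hz] at hspec
      exact absurd (by simpa using hspec) hne.not_ge
    · have := hmin k (by omega)
      obtain ⟨u, hu, huJ⟩ := SetLike.not_le_iff_exists.mp this
      refine ⟨u, Ideal.mul_le_right hu, huJ, fun x hx => ?_⟩
      rw [hk', pow_succ', mul_assoc] at hspec
      exact hspec (Ideal.mul_mem_mul (I := maximalIdeal S) hx hu)
  have hJ1 : J < J ⊔ Ideal.span {u} := by
    refine left_lt_sup.mpr fun hle => huJ ((Ideal.span_singleton_le_iff_mem _).mp hle)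
  have hcolon : J.colon {u} = maximalIdeal S := by
    refine le_antisymm (le_maximalIdeal fun htop => huJ ?_) fun x hx => ?_
    · rw [Ideal.eq_top_iff_one, Submodule.mem_colon_singleton] at htop
      simpa using htop
    · exact Submodule.mem_colon_singleton.mpr (hu x hx)
  have h1 := length_quotient_eq_colon_add_sup J u
  have h2 := length_quotient_eq_colon_add_sup (J.map φ) (φ u)
  have hle : (maximalIdeal S).map φ ≤ (J.map φ).colon {φ u} := by
    rw [Ideal.map_le_iff_le_comap]
    intro x hx
    rw [Ideal.mem_comap, Submodule.mem_colon_singleton, smul_eq_mul, ← map_mul]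
    exact Ideal.mem_map_of_mem _ (hu x hx)
  have h3 := length_quotient_le_of_le hle
  have h4 := ih _ hJ1 (sup_le h ((Ideal.span_singleton_le_iff_mem _).mpr huJ'))
    (hk.imp fun k hk => hk.trans le_sup_left)
  have hmap : (J ⊔ Ideal.span {u}).map φ = J.map φ ⊔ Ideal.span {φ u} := by
    rw [Ideal.map_sup, Ideal.map_span, Set.image_singleton]
  have h5 : Module.length S (S ⧸ maximalIdeal S) = 1 := by
    rw [Module.length_eq_one_iff]
    exact isSimpleModule_iff_isCoatom.mpr (Ideal.isMaximal_def.mp inferInstance)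
  rw [hmap] at h4
  rw [hcolon, h5] at h1
  rw [h1, h2, mul_add, mul_one]
  calc _ ≤ _ := add_le_add_left (add_le_add_left h3 _) _
    _ = Module.length S (S ⧸ (maximalIdeal S).map φ) + _ := add_assoc _ _ _
    _ ≤ _ := add_le_add_right h4 _
    _ = _ := by ring

end

section
variable {S : Type u} [CommRing S] [IsLocalRing S]

theorem length_quotient_ofList_pow {rs : List S} (hrs : IsWeaklyRegular S rs)
    (hm : Ideal.ofList rs = maximalIdeal S) {a : ℕ} (ha : a ≠ 0) :
    Module.length S (S ⧸ Ideal.ofList (rs.map (· ^ a))) = (a : ℕ∞) ^ rs.length := by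
  have h := (weaklyRegular_pow_and_length a ha rs hrs).2
  have h1 : Module.length S (S ⧸ maximalIdeal S) = 1 := by
    rw [Module.length_eq_one_iff]
    exact isSimpleModule_iff_isCoatom.mpr (Ideal.isMaximal_def.mp inferInstance)
  rw [smul_eq_mul, Ideal.mul_top, smul_eq_mul, Ideal.mul_top, hm, h1, mul_one] at h
  exact h

variable [IsNoetherianRing S] {φ : S →+* S} {q : ℕ}

theorem length_quotient_map_eq (hφ : ∀ x, φ x = x ^ q) (hq : q ≠ 0) {rs : List S}
    (hrs : IsWeaklyRegular S rs) (hm : Ideal.ofList rs = maximalIdeal S) {J : Ideal S}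
    (hJ : ∃ k, maximalIdeal S ^ k ≤ J) :
    Module.length S (S ⧸ J.map φ) = (q : ℕ∞) ^ rs.length * Module.length S (S ⧸ J) ∧
      Module.length S (S ⧸ J) ≠ ⊤ := by
  obtain ⟨k, hk⟩ := hJ
  set L : Ideal S := Ideal.ofList (rs.map (· ^ (k + 1))) with hL
  have hLmap : L.map φ = Ideal.ofList (rs.map (· ^ ((k + 1) * q))) := by
    rw [hL, Ideal.map_ofList, List.map_map]
    congr 2
    funext x
    simp [hφ, pow_mul]
  have hmmap : (maximalIdeal S).map φ = Ideal.ofList (rs.map (· ^ q)) := by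
    rw [← hm, Ideal.map_ofList]
    congr 2
    funext x
    exact hφ x
  have hlm : Module.length S (S ⧸ (maximalIdeal S).map φ) = (q : ℕ∞) ^ rs.length := by
    rw [hmmap, length_quotient_ofList_pow hrs hm hq]
  have hlL : Module.length S (S ⧸ L) = ((k + 1 : ℕ) : ℕ∞) ^ rs.length :=
    length_quotient_ofList_pow hrs hm k.succ_ne_zero
  have hlLφ : Module.length S (S ⧸ L.map φ) = (((k + 1) * q : ℕ) : ℕ∞) ^ rs.length := by
    rw [hLmap, length_quotient_ofList_pow hrs hm (mul_ne_zero k.succ_ne_zero hq)]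
  have hLJ : L ≤ J := by
    refine le_trans ?_ hk
    rw [hL, Ideal.ofList, Ideal.span_le]
    rintro _ hx
    obtain ⟨r, hr, rfl⟩ := List.mem_map.mp hx
    exact Ideal.pow_le_pow_right k.le_succ (Ideal.pow_mem_pow (hm ▸ Ideal.subset_span hr) _)
  have hLk : ∃ l, maximalIdeal S ^ l * J ≤ L := by
    obtain ⟨l, hl⟩ := Ideal.exists_pow_le_of_le_radical_of_fg (I := maximalIdeal S) (J := L) (by
      rw [← hm, Ideal.ofList, Ideal.span_le]
      exact fun r hr => ⟨k + 1, Ideal.subset_span (List.mem_map_of_mem hr)⟩)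
      (IsNoetherian.noetherian _)
    exact ⟨l, Ideal.mul_le_left.trans hl⟩
  have hfin : Module.length S (S ⧸ J) ≠ ⊤ := by
    refine ne_top_of_le_ne_top ?_ (length_quotient_le_of_le hLJ)
    rw [hlL]
    exact_mod_cast ENat.natCast_ne_top ((k + 1) ^ rs.length)
  refine ⟨le_antisymm ?_ ?_, hfin⟩
  · have h := length_quotient_map_add_le φ (J' := ⊤) J le_top ⟨k, Ideal.mul_le_left.trans hk⟩
    have h0 : Module.length S (S ⧸ (⊤ : Ideal S)) = 0 := by
      rw [Module.length_eq_zero_iff]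
      infer_instance
    rwa [Ideal.map_top, h0, mul_zero, add_zero, zero_add, hlm] at h
  · have h := length_quotient_map_add_le φ L hLJ hLk
    rw [hlm, hlL, hlLφ, Nat.cast_mul, mul_pow, mul_comm (_ ^ _) (_ ^ _), add_comm] at h
    refine (ENat.add_le_add_iff_right ?_).mp h
    exact_mod_cast ENat.natCast_ne_top (q ^ rs.length * (k + 1) ^ rs.length)

theorem map_colon_singleton_of_pow_le (hφ : ∀ x, φ x = x ^ q) (hq : q ≠ 0) {rs : List S}
    (hrs : IsWeaklyRegular S rs) (hm : Ideal.ofList rs = maximalIdeal S) {J : Ideal S}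
    (hJ : ∃ k, maximalIdeal S ^ k ≤ J) (s : S) :
    (J.colon {s} : Ideal S).map φ = (J.map φ).colon {φ s} := by
  have hJs : J ≤ J.colon {s} := Ideal.le_colon
  have hle : (J.colon {s} : Ideal S).map φ ≤ (J.map φ).colon {φ s} := by
    rw [Ideal.map_le_iff_le_comap]
    intro x hx
    rw [Submodule.mem_colon_singleton, smul_eq_mul] at hx
    rw [Ideal.mem_comap, Submodule.mem_colon_singleton, smul_eq_mul, ← map_mul]
    exact Ideal.mem_map_of_mem _ hx
  obtain ⟨h1, h1'⟩ := length_quotient_map_eq hφ hq hrs hm (hJ.imp fun k hk => hk.trans hJs)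
  obtain ⟨h2, h2'⟩ := length_quotient_map_eq hφ hq hrs hm hJ
  obtain ⟨h3, h3'⟩ := length_quotient_map_eq hφ hq hrs hm (J := J ⊔ Ideal.span {s})
    (hJ.imp fun k hk => hk.trans le_sup_left)
  have h4 := length_quotient_eq_colon_add_sup J s
  have h5 := length_quotient_eq_colon_add_sup (J.map φ) (φ s)
  have hmap : (J ⊔ Ideal.span {s}).map φ = J.map φ ⊔ Ideal.span {φ s} := by
    rw [Ideal.map_sup, Ideal.map_span, Set.image_singleton]
  have hK : (q : ℕ∞) ^ rs.length ≠ ⊤ := by exact_mod_cast ENat.natCast_ne_top (q ^ rs.length)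
  refine eq_of_le_of_length_quotient_eq hle (h1 ▸ WithTop.mul_ne_top hK h1') ?_
  rw [h2, h4, ← hmap, h3, mul_add] at h5
  rw [h1]
  exact ENat.add_left_injective_of_ne_top (WithTop.mul_ne_top hK h3') h5

theorem mk_mem_smul_top_iff {S : Type u} [CommRing S] (I K : Ideal S) (x : S) :
    (Submodule.Quotient.mk x : S ⧸ I) ∈ (K • ⊤ : Submodule S (S ⧸ I)) ↔ x ∈ I ⊔ K := by
  have h : (K • ⊤ : Submodule S (S ⧸ I)) = Submodule.map (Submodule.mkQ I) K := by
    rw [← Submodule.range_mkQ I, LinearMap.range_eq_map, ← Submodule.map_smul'', smul_eq_mul,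
      Ideal.mul_top]
  rw [h, ← Submodule.mkQ_apply, ← Submodule.mem_comap, Submodule.comap_map_mkQ]

theorem exists_colon_sup_pow_le {I : Ideal S} {s : S} (hs : ∀ x, x * s ∈ I → x ∈ I) (N : ℕ) :
    ∃ k, ((I ⊔ maximalIdeal S ^ k).colon {s} : Ideal S) ≤ I ⊔ maximalIdeal S ^ N := by
  let f : S ⧸ I →ₗ[S] S ⧸ I := LinearMap.lsmul S (S ⧸ I) s
  have hf (x : S) : f (Submodule.Quotient.mk x) = Submodule.Quotient.mk (s * x) := rfl
  have hinj : Injective f := by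
    rw [← LinearMap.ker_eq_bot, LinearMap.ker_eq_bot']
    intro x hx
    obtain ⟨x, rfl⟩ := Submodule.Quotient.mk_surjective _ x
    rw [hf, Submodule.Quotient.mk_eq_zero, mul_comm] at hx
    exact (Submodule.Quotient.mk_eq_zero _).mpr (hs x hx)
  obtain ⟨c, hc⟩ := Ideal.exists_pow_inf_eq_pow_smul (maximalIdeal S) (LinearMap.range f)
  refine ⟨N + c, fun x hx => ?_⟩
  rw [Submodule.mem_colon_singleton, smul_eq_mul, mul_comm, ← mk_mem_smul_top_iff] at hx
  have h1 : f (Submodule.Quotient.mk x) ∈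
      (maximalIdeal S ^ (N + c) • ⊤ ⊓ LinearMap.range f : Submodule S (S ⧸ I)) :=
    ⟨hx, LinearMap.mem_range_self _ _⟩
  rw [hc _ (Nat.le_add_left c N), Nat.add_sub_cancel] at h1
  have h2 := Submodule.smul_mono le_rfl
    (inf_le_right : maximalIdeal S ^ c • ⊤ ⊓ LinearMap.range f ≤ _) h1
  rw [LinearMap.range_eq_map, ← Submodule.map_smul''] at h2
  obtain ⟨z, hz, hzx⟩ := h2
  rw [← mk_mem_smul_top_iff, ← hinj hzx]
  exact hz

theorem mem_map_of_mul_mem_map (hφ : ∀ x, φ x = x ^ q) (hq : q ≠ 0) {rs : List S}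
    (hrs : IsWeaklyRegular S rs) (hm : Ideal.ofList rs = maximalIdeal S) {I : Ideal S} {s : S}
    (hs : ∀ x, x * s ∈ I → x ∈ I) {y : S} (hy : y * φ s ∈ I.map φ) : y ∈ I.map φ := by
  have hmem (N : ℕ) : y ∈ I.map φ ⊔ maximalIdeal S ^ N := by
    obtain ⟨k, hk⟩ := exists_colon_sup_pow_le hs N
    have h1 : y ∈ ((I ⊔ maximalIdeal S ^ k).map φ).colon {φ s} :=
      Submodule.mem_colon_singleton.mpr (Ideal.map_mono le_sup_left hy)
    rw [← map_colon_singleton_of_pow_le hφ hq hrs hm ⟨k, le_sup_right⟩] at h1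
    have h2 := Ideal.map_mono (f := φ) hk h1
    rw [Ideal.map_sup] at h2
    refine sup_le_sup_left (a := (maximalIdeal S ^ N).map φ) ?_ _ h2
    rw [Ideal.map_le_iff_le_comap]
    intro x hx
    rw [Ideal.mem_comap, hφ]
    exact Ideal.pow_mem_of_mem _ hx _ (Nat.pos_of_ne_zero hq)
  rw [← Submodule.Quotient.mk_eq_zero (I.map φ), ← Submodule.mem_bot S,
    ← Ideal.iInf_pow_smul_eq_bot_of_isLocalRing (maximalIdeal S) Ideal.IsPrime.ne_top',
    Submodule.mem_iInf]
  intro N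
  exact (mk_mem_smul_top_iff ..).mpr (hmem N)
end

end

section
variable {S : Type u} [CommRing S]

theorem Ideal.pow_mem_bracketPow {I : Ideal S} {x : S} (hx : x ∈ I) (q : ℕ) :
    x ^ q ∈ I.bracketPow q :=
  Ideal.subset_span ⟨x, hx, rfl⟩

theorem Ideal.bracketPow_mono {I J : Ideal S} (h : I ≤ J) (q : ℕ) :
    I.bracketPow q ≤ J.bracketPow q :=
  Ideal.span_mono (Set.image_mono h)

theorem Ideal.pow_mul_mem_bracketPow {I J : Ideal S} {s : S} (h : ∀ x ∈ I, s * x ∈ J) {q : ℕ}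
    {y : S} (hy : y ∈ I.bracketPow q) : s ^ q * y ∈ J.bracketPow q := by
  have hle : I.bracketPow q ≤ (J.bracketPow q).colon {s ^ q} := by
    rw [Ideal.bracketPow, Ideal.span_le]
    rintro _ ⟨x, hx, rfl⟩
    rw [SetLike.mem_coe, Submodule.mem_colon_singleton, smul_eq_mul, mul_comm, ← mul_pow]
    exact Ideal.pow_mem_bracketPow (h x hx) q
  simpa [Submodule.mem_colon_singleton, mul_comm] using hle hy

theorem Ideal.not_le_bracketPow [IsLocalRing S] [IsNoetherianRing S] {I : Ideal S} (h0 : I ≠ ⊥)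
    (h1 : I ≠ ⊤) {q : ℕ} (hq : 2 ≤ q) : ¬ I ≤ I.bracketPow q := by
  refine fun hle => h0 (Submodule.eq_bot_of_le_smul_of_le_jacobson_bot (maximalIdeal S) _
    (IsNoetherian.noetherian _) (hle.trans ?_) (maximalIdeal_le_jacobson _))
  rw [Ideal.bracketPow, Ideal.span_le]
  rintro _ ⟨x, hx, rfl⟩
  obtain ⟨k, rfl⟩ := Nat.exists_eq_add_of_le' hq
  have h : x ^ (k + 1) * x ∈ maximalIdeal S * I := by
    refine Ideal.mul_mem_mul ?_ hx
    exact Ideal.pow_mem_of_mem _ (le_maximalIdeal h1 hx) _ k.succ_pos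
  simpa [← pow_succ] using h

variable [IsNoetherianRing S] [IsLocalRing S] (p : ℕ) [Fact p.Prime] [CharP S p]

theorem IsRegularLocal.mem_bracketPow_of_mul_pow_mem (hreg : IsRegularLocal S) (n : ℕ)
    {I : Ideal S} {s : S} (hs : ∀ x, x * s ∈ I → x ∈ I) {y : S}
    (hy : y * s ^ p ^ n ∈ I.bracketPow (p ^ n)) : y ∈ I.bracketPow (p ^ n) := by
  obtain ⟨s, hcard, hspan⟩ := hreg
  have hm : Ideal.ofList s.toList = maximalIdeal S := by
    rw [← hspan, Ideal.ofList]
    congr 1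
    ext
    simp
  have : ExpChar S p := .prime Fact.out
  exact mem_map_of_mul_mem_map (φ := iterateFrobenius S p n) (fun _ => rfl)
    (pow_ne_zero n (Fact.out : p.Prime).ne_zero)
    (isWeaklyRegular_of_ofList_eq_maximalIdeal _ s.length_toList hm hcard.le) hm hs hy

theorem IsRegularLocal.mem_bracketPow_of_mul_mem (hreg : IsRegularLocal S) (n : ℕ)
    {Q : Ideal S} (hQ : Q.IsPrimary) {s : S} (hs : s ∉ Q.radical) {y : S}
    (hy : y * s ∈ Q.bracketPow (p ^ n)) : y ∈ Q.bracketPow (p ^ n) := by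
  refine hreg.mem_bracketPow_of_mul_pow_mem p n (s := s)
    (fun x hx => ((Ideal.isPrimary_iff.mp hQ).2 hx).resolve_right hs) ?_
  obtain ⟨k, hk⟩ := Nat.exists_eq_add_of_le' (Nat.one_le_pow n p (Fact.out : p.Prime).pos)
  rw [hk, pow_succ', ← mul_assoc]
  exact hk ▸ Ideal.mul_mem_right _ _ hy

theorem IsMinimalPrimaryDecomposition.exists_mul_mem {S : Type u} [CommRing S] {𝔄 : Ideal S}
    {t : ℕ} {Q : Fin t → Ideal S} (hdec : IsMinimalPrimaryDecomposition 𝔄 Q) {i : Fin t}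
    (hi : (Q i).radical ∈ 𝔄.minimalPrimes) :
    ∃ s ∉ (Q i).radical, ∀ x ∈ Q i, s * x ∈ 𝔄 := by
  obtain ⟨hA, hprim, hinj, -⟩ := hdec
  have hp : (Q i).radical.IsPrime := hi.1.1
  have h (j : Fin t) : ∃ s ∉ (Q i).radical, j ≠ i → s ∈ Q j := by
    obtain rfl | hji := eq_or_ne j i
    · exact ⟨1, (Ideal.ne_top_iff_one _).mp hp.ne_top, fun h => absurd rfl h⟩
    have hnot : ¬ Q j ≤ (Q i).radical := fun hle => by
      have h1 : (Q j).radical ≤ (Q i).radical := hp.isRadical.radical_le_iff.mpr hle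
      have h2 : 𝔄 ≤ (Q j).radical := (hA.trans_le (iInf_le Q j)).trans Ideal.le_radical
      have h3 := hi.2 ⟨(Ideal.isPrime_radical (hprim j)), h2⟩ h1
      exact hji (hinj (le_antisymm h1 h3))
    obtain ⟨s, hs, hs'⟩ := SetLike.not_le_iff_exists.mp hnot
    exact ⟨s, hs', fun _ => hs⟩
  choose s hs hsQ using h
  refine ⟨∏ j, s j, fun hmem => ?_, fun x hx => ?_⟩
  · obtain ⟨j, -, hj⟩ := hp.prod_mem_iff.mp hmem
    exact hs j hj
  · rw [hA, Submodule.mem_iInf]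
    intro j
    obtain rfl | hji := eq_or_ne j i
    · exact Ideal.mul_mem_left _ _ hx
    · refine Ideal.mul_mem_right _ _ (Ideal.mem_of_dvd _ ?_ (hsQ j hji))
      exact Finset.dvd_prod_of_mem s (Finset.mem_univ j)
end

theorem primary_component_of_bracket_pow_colon (S : Type u) [CommRing S] [IsNoetherianRing S] [IsLocalRing S]
    (p : ℕ) [Fact p.Prime] [CharP S p] (hreg : IsRegularLocal S)
    (𝔄 : Ideal S) (h0 : 𝔄 ≠ ⊥) (h1 : 𝔄 ≠ ⊤)
    (t : ℕ) (Q : Fin t → Ideal S) (hdec : IsMinimalPrimaryDecomposition 𝔄 Q)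
    (n : ℕ) (hn : 1 ≤ n) :
    Submodule.colon (Ideal.bracketPow 𝔄 (p ^ n)) 𝔄 ≠ ⊤ ∧
      ∀ (i : Fin t) (𝔓 : Ideal S) [𝔓.IsPrime], (Q i).radical = 𝔓 →
        𝔓 ∈ 𝔄.minimalPrimes →
        𝔓 ∈ (Submodule.colon (Ideal.bracketPow 𝔄 (p ^ n)) 𝔄).minimalPrimes ∧
          Ideal.comap (algebraMap S (Localization.AtPrime 𝔓))
              (Ideal.map (algebraMap S (Localization.AtPrime 𝔓))
                (Submodule.colon (Ideal.bracketPow 𝔄 (p ^ n)) 𝔄)) =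
            Submodule.colon (Ideal.bracketPow (Q i) (p ^ n)) (Q i) := by
  have hp : p.Prime := Fact.out
  have hq2 : 2 ≤ p ^ n := hp.two_le.trans (Nat.le_self_pow (by omega) p)
  refine ⟨fun htop => Ideal.not_le_bracketPow h0 h1 hq2
    ((Submodule.colon_eq_top_iff_subset _).mp htop), ?_⟩
  rintro i 𝔓 h𝔓 rfl hmin
  obtain ⟨s, hs, hsQ⟩ := hdec.exists_mul_mem hmin
  have hprim := hdec.2.1 i
  have hAQ : 𝔄 ≤ Q i := hdec.1.trans_le (iInf_le Q i)
  have hQ0 : Q i ≠ ⊥ := fun h => h0 (le_bot_iff.mp (h ▸ hAQ))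
  have hQ1 : Q i ≠ ⊤ := fun h => h𝔓.ne_top (by rw [h, Ideal.radical_top])
  have hmem (x : S) : x ∈ Submodule.colon (Ideal.bracketPow (Q i) (p ^ n)) (Q i) ↔
      ∃ r ∉ (Q i).radical, r * x ∈ Submodule.colon (Ideal.bracketPow 𝔄 (p ^ n)) 𝔄 := by
    simp only [Submodule.mem_colon, smul_eq_mul, SetLike.mem_coe]
    refine ⟨fun hx => ⟨s ^ p ^ n, fun h => hs (h𝔓.mem_of_pow_mem _ h), fun a ha => ?_⟩, ?_⟩
    · rw [mul_assoc]
      exact Ideal.pow_mul_mem_bracketPow hsQ (hx a (hAQ ha))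
    · rintro ⟨r, hr, hx⟩ a ha
      refine hreg.mem_bracketPow_of_mul_mem p n hprim (s := r * s)
        (fun h => (h𝔓.mem_or_mem h).elim hr hs) (Ideal.bracketPow_mono hAQ _ ?_)
      convert hx _ (hsQ a ha) using 1
      ring
  have hle : Submodule.colon (Ideal.bracketPow 𝔄 (p ^ n)) 𝔄 ≤ (Q i).radical := by
    intro x hx
    by_contra hxP
    have h : (1 : S) ∈ Submodule.colon (Ideal.bracketPow (Q i) (p ^ n)) (Q i) :=
      (hmem 1).mpr ⟨x, hxP, by rwa [mul_one]⟩
    rw [← Ideal.eq_top_iff_one, Submodule.colon_eq_top_iff_subset] at h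
    exact Ideal.not_le_bracketPow hQ0 hQ1 hq2 h
  refine ⟨⟨⟨h𝔓, hle⟩, fun P' hP' hP'le => ?_⟩, ?_⟩
  · have := hP'.1
    refine hmin.2 ⟨hP'.1, fun a ha => this.mem_of_pow_mem (p ^ n) (hP'.2 ?_)⟩ hP'le
    exact Ideal.le_colon (Ideal.pow_mem_bracketPow ha (p ^ n))
  · ext x
    rw [hmem, Ideal.mem_comap,
      IsLocalization.algebraMap_mem_map_algebraMap_iff (Q i).radical.primeCompl]
    rfl
end

section
/- Suppose R is F-finite. Then the 𝔪-adic completion R̂ of R is again F-finite, and if 𝔞 is a uniformly F-compatible ideal of R, then 𝔞R̂ is a uniformly F-compatible ideal of R̂. -/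
open TensorProduct IsLocalRing DirectSum

universe u v

/-! ### Generalities on adic topologies -/

theorem Ideal.mem_smul_top_pi {S : Type*} [CommRing S] {ι : Type*} [Finite ι] (I : Ideal S)
    (x : ι → S) : x ∈ (I • ⊤ : Submodule S (ι → S)) ↔ ∀ i, x i ∈ I := by
  classical
  cases nonempty_fintype ι
  refine ⟨fun hx i => ?_, fun hx => ?_⟩
  · have h := Submodule.mem_map_of_mem (f := LinearMap.proj (R := S) (φ := fun _ : ι => S) i) hx
    rw [Submodule.map_smul''] at h
    simpa using (Submodule.smul_mono le_rfl le_top : _ ≤ I • (⊤ : Submodule S S)) h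
  · rw [pi_eq_sum_univ x]
    exact Submodule.sum_mem _ fun i _ => Submodule.smul_mem_smul (hx i) trivial

theorem IsPrecomplete.pi {S : Type*} [CommRing S] (I : Ideal S) [IsPrecomplete I S]
    (ι : Type*) [Finite ι] : IsPrecomplete I (ι → S) := by
  refine ⟨fun f hf => ?_⟩
  have hcoord (i : ι) : ∃ L : S, ∀ n, f n i ≡ L [SMOD (I ^ n • ⊤ : Submodule S S)] := by
    refine IsPrecomplete.prec' (I := I) (fun n => f n i) fun {m n} hmn => ?_
    have := hf hmn
    rw [SModEq.sub_mem, Ideal.mem_smul_top_pi] at this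
    simpa [SModEq.sub_mem] using this i
  choose L hL using hcoord
  refine ⟨L, fun n => ?_⟩
  rw [SModEq.sub_mem, Ideal.mem_smul_top_pi]
  intro i
  simpa [SModEq.sub_mem] using hL i n

/-- A Hausdorff module over an adically complete ring is finite if it is finite modulo the
ideal of definition. -/
theorem Module.Finite.of_span_sup_smul_top {S M : Type*} [CommRing S] [AddCommGroup M]
    [Module S M] (I : Ideal S) [IsPrecomplete I S] [IsHausdorff I M] {k : ℕ} (t : Fin k → M)
    (ht : Submodule.span S (Set.range t) ⊔ I • ⊤ = ⊤) : Module.Finite S M := by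
  have := IsPrecomplete.pi I (Fin k)
  refine Module.Finite.of_surjective (Fintype.linearCombination S t)
    (surjective_of_mkQ_comp_surjective (I := I) fun y => ?_)
  obtain ⟨y, rfl⟩ := Submodule.mkQ_surjective _ y
  obtain ⟨a, ha, b, hb, rfl⟩ := Submodule.mem_sup.1 (ht ▸ Submodule.mem_top : y ∈ _)
  rw [← Fintype.range_linearCombination] at ha
  obtain ⟨x, rfl⟩ := ha
  refine ⟨x, ?_⟩
  simpa using hb

/-- Linear maps from a finite module to the completion can be approximated by linear maps
to the ring itself. -/
theorem LinearMap.exists_sub_algebraMap_mem {S T M : Type*} [CommRing S] [IsNoetherianRing S]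
    [CommRing T] [Algebra S T] [AddCommGroup M] [Module S M] [Module.Finite S M] (I : Ideal S)
    (hsurj : ∀ n (y : T), ∃ x : S, y - algebraMap S T x ∈ (I ^ n).map (algebraMap S T))
    (hinj : ∀ n (x : S), algebraMap S T x ∈ (I ^ n).map (algebraMap S T) → x ∈ I ^ n)
    (g : M →ₗ[S] T) (N : ℕ) :
    ∃ h : M →ₗ[S] S, ∀ m, g m - algebraMap S T (h m) ∈ (I ^ N).map (algebraMap S T) := by
  obtain ⟨k, π, hπ⟩ := Module.Finite.exists_fin' S M
  obtain ⟨l, q, hq⟩ := Module.Finite.exists_fin' S (LinearMap.ker π)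
  let B : Matrix (Fin l) (Fin k) S := fun j => (q (Pi.single j 1) : Fin k → S)
  obtain ⟨c, hc⟩ := I.exists_pow_inf_eq_pow_smul (LinearMap.range B.mulVecLin)
  let y : Fin k → T := fun i => g (π (Pi.single i 1))
  have hgy (v : Fin k → S) : g (π v) = ∑ i, v i • y i := by
    conv_lhs => rw [pi_eq_sum_univ' v]
    simp [y, map_sum]
  choose x₀ hx₀ using fun i => hsurj (N + c) (y i)
  have hBx₀ : B.mulVecLin x₀ ∈ (I ^ (N + c) • ⊤ : Submodule S (Fin l → S)) := by
    rw [Ideal.mem_smul_top_pi]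
    intro j
    refine hinj _ _ ?_
    have h0 : ∑ i, B j i • y i = 0 := by
      rw [← hgy, LinearMap.mem_ker.1 (q (Pi.single j 1)).2, map_zero]
    have : algebraMap S T (B.mulVecLin x₀ j)
        = -∑ i, algebraMap S T (B j i) * (y i - algebraMap S T (x₀ i)) := by
      simp only [mul_sub, Finset.sum_sub_distrib]
      simp only [Algebra.smul_def] at h0
      simp [h0, Matrix.mulVec, dotProduct]
    rw [this]
    exact neg_mem (sum_mem fun i _ => Ideal.mul_mem_left _ _ (hx₀ i))
  have hz : B.mulVecLin x₀ ∈ Submodule.map B.mulVecLin (I ^ N • ⊤) := by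
    have h := hc (N + c) (Nat.le_add_left _ _)
    rw [Nat.add_sub_cancel] at h
    have h' := h.le ⟨hBx₀, LinearMap.mem_range_self _ _⟩
    rw [Submodule.map_smul'', Submodule.map_top]
    exact Submodule.smul_mono le_rfl inf_le_right h'
  obtain ⟨z, hz, hBz⟩ := hz
  let x := x₀ - z
  have hBx : B.mulVecLin x = 0 := by rw [map_sub, hBz, sub_self]
  have hxy (i) : y i - algebraMap S T (x i) ∈ (I ^ N).map (algebraMap S T) := by
    have h1 := Ideal.map_mono (f := algebraMap S T) (Ideal.pow_le_pow_right (Nat.le_add_right N c))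
      (hx₀ i)
    have h2 := Ideal.mem_map_of_mem (algebraMap S T) ((Ideal.mem_smul_top_pi _ _).1 hz i)
    have := add_mem h1 h2
    simpa [x, sub_add] using this
  let ψ : (Fin k → S) →ₗ[S] S := Fintype.linearCombination S x
  have hker : LinearMap.ker π ≤ LinearMap.ker ψ := by
    intro v hv
    obtain ⟨w, hw⟩ := hq ⟨v, hv⟩
    have hcomp : ψ ∘ₗ (LinearMap.ker π).subtype ∘ₗ q = 0 := by
      ext j
      have : ∑ i, B j i * x i = 0 := congrFun hBx j
      simpa [ψ, Fintype.linearCombination_apply, B] using this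
    simpa [hw] using LinearMap.congr_fun hcomp w
  refine ⟨(LinearMap.ker π).liftQ ψ hker ∘ₗ (π.quotKerEquivOfSurjective hπ).symm, fun m => ?_⟩
  obtain ⟨v, rfl⟩ := hπ m
  have : (π.quotKerEquivOfSurjective hπ).symm (π v) = Submodule.Quotient.mk v := by
    rw [LinearEquiv.symm_apply_eq]
    rfl
  rw [LinearMap.comp_apply, LinearEquiv.coe_coe, this, Submodule.liftQ_apply, hgy]
  simp only [ψ, Fintype.linearCombination_apply, map_sum, smul_eq_mul, map_mul,
    ← Finset.sum_sub_distrib, Algebra.smul_def, ← mul_sub]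
  exact sum_mem fun i _ => Ideal.mul_mem_left _ _ (hxy i)

/-! ### Frobenius twists -/

namespace FrobAlg

variable (S : Type u) (p n : ℕ) [CommRing S] [Fact p.Prime] [CharP S p]

theorem algebraMap_apply_s14 (r : S) : algebraMap S (FrobAlg S p n) r = of S p n (r ^ p ^ n) := by
  change ((frobenius S p) ^ n) r = r ^ p ^ n
  rw [RingHom.coe_pow, iterate_frobenius]

theorem finite_of_isFFinite (h : IsFFinite S p) : Module.Finite S (FrobAlg S p n) := by
  have h1 : (frobenius S p).Finite := by
    have : (algebraMap S (FrobAlg S p 1)).Finite := RingHom.finite_algebraMap.2 h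
    change ((frobenius S p) ^ 1 : S →+* S).Finite at this
    rwa [pow_one] at this
  have hn (n : ℕ) : ((frobenius S p) ^ n : S →+* S).Finite := by
    induction n with
    | zero => exact RingHom.Finite.id S
    | succ n ih => exact ih.comp h1
  exact RingHom.finite_algebraMap.1 (hn n : (algebraMap S (FrobAlg S p n)).Finite)

variable {S}

theorem exists_pow_of_mem_smul_top [IsNoetherianRing S] (I : Ideal S) (N : ℕ) :
    ∃ K, ∀ b ∈ I ^ K, of S p n b ∈ (I ^ N • ⊤ : Submodule S (FrobAlg S p n)) := by
  let J : Ideal S := (I ^ N).map (algebraMap S (FrobAlg S p n))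
  have hI : I ≤ J.radical := fun x hx => by
    refine ⟨p ^ n * N, ?_⟩
    have := Ideal.mem_map_of_mem (algebraMap S (FrobAlg S p n)) (Ideal.pow_mem_pow hx N)
    rw [algebraMap_apply_s14, ← pow_mul, mul_comm] at this
    exact this
  obtain ⟨K, hK⟩ := Ideal.exists_pow_le_of_le_radical_of_fg hI (IsNoetherian.noetherian I)
  refine ⟨K, fun b hb => ?_⟩
  rw [Ideal.smul_top_eq_map]
  exact hK hb

theorem isHausdorff (I : Ideal S) [IsHausdorff I S] : IsHausdorff I (FrobAlg S p n) := by
  refine ⟨fun x hx => ?_⟩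
  have hmem (k : ℕ) : (show S from x) ∈ I ^ k := by
    have h := hx k
    rw [SModEq.zero, Ideal.smul_top_eq_map] at h
    have hle : (I ^ k).map (algebraMap S (FrobAlg S p n)) ≤ (show Ideal S from I ^ k) :=
      Ideal.map_le_iff_le_comap.2 fun r hr => by
        change algebraMap S (FrobAlg S p n) r ∈ (show Ideal S from I ^ k)
        rw [algebraMap_apply_s14]
        exact Ideal.pow_mem_of_mem _ hr _ (pow_pos (Fact.out : p.Prime).pos n)
    exact hle h
  exact IsHausdorff.haus (I := I) inferInstance (show S from x) fun k =>
    SModEq.zero.2 (by simpa using hmem k)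

variable {T : Type u} [CommRing T] [CharP T p] [Algebra S T]

/-- The map `S^{(n)} → T^{(n)}` induced by an algebra structure map `S → T`. -/
def mapAlgebraMap : FrobAlg S p n →ₛₗ[algebraMap S T] FrobAlg T p n where
  toFun x := of T p n (algebraMap S T x)
  map_add' := map_add (algebraMap S T)
  map_smul' r x := by
    rw [Algebra.smul_def, Algebra.smul_def, algebraMap_apply_s14, algebraMap_apply_s14, ← map_pow]
    exact map_mul (algebraMap S T) _ _

/-- The restriction to `S^{(n)}` of a `T`-linear map `T^{(n)} → T`. -/
def restrict (φ : FrobAlg T p n →ₗ[T] T) : FrobAlg S p n →ₗ[S] T where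
  toFun x := φ (mapAlgebraMap p n x)
  map_add' x y := by rw [map_add, map_add]
  map_smul' r x := by
    rw [LinearMap.map_smulₛₗ, LinearMap.map_smul, RingHom.id_apply, algebraMap_smul]

end FrobAlg

/-- The image of an ideal is dense in its extension, for a ring map with dense image. -/
theorem Ideal.exists_mem_sub_algebraMap_mem {S T : Type*} [CommRing S] [CommRing T] [Algebra S T]
    (𝔞 : Ideal S) (J : Ideal T) (hsurj : ∀ y : T, ∃ x : S, y - algebraMap S T x ∈ J) {b : T}
    (hb : b ∈ 𝔞.map (algebraMap S T)) : ∃ a ∈ 𝔞, b - algebraMap S T a ∈ J := by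
  induction hb using Submodule.span_induction with
  | mem x hx =>
    obtain ⟨a, ha, rfl⟩ := hx
    exact ⟨a, ha, by simp⟩
  | zero => exact ⟨0, zero_mem _, by simp⟩
  | add x y _ _ hx hy =>
    obtain ⟨a, ha, ha'⟩ := hx
    obtain ⟨b, hb, hb'⟩ := hy
    exact ⟨a + b, add_mem ha hb, by simpa [add_sub_add_comm] using add_mem ha' hb'⟩
  | smul s x _ hx =>
    obtain ⟨a, ha, ha'⟩ := hx
    obtain ⟨r, hr⟩ := hsurj s
    refine ⟨r * a, 𝔞.mul_mem_left _ ha, ?_⟩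
    have : s • x - algebraMap S T (r * a)
        = s * (x - algebraMap S T a) + algebraMap S T a * (s - algebraMap S T r) := by
      rw [map_mul, smul_eq_mul]
      ring
    rw [this]
    exact add_mem (J.mul_mem_left _ ha') (J.mul_mem_left _ hr)

/-- Ideals of a Noetherian local ring are closed in the adic topology. -/
theorem IsLocalRing.mem_of_forall_mem_sup_pow {S : Type*} [CommRing S] [IsNoetherianRing S]
    [IsLocalRing S] (J : Ideal S) {x : S} (hx : ∀ N, x ∈ J ⊔ maximalIdeal S ^ N) : x ∈ J := by
  have h := Ideal.iInf_pow_smul_eq_bot_of_isLocalRing (M := S ⧸ J) (maximalIdeal S)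
    (Ideal.IsMaximal.ne_top inferInstance)
  rw [← Ideal.Quotient.eq_zero_iff_mem, ← Submodule.mem_bot S, ← h, Submodule.mem_iInf]
  intro N
  obtain ⟨a, ha, b, hb, rfl⟩ := Submodule.mem_sup.1 (hx N)
  rw [map_add, Ideal.Quotient.eq_zero_iff_mem.2 ha, zero_add, ← mul_one b, map_mul]
  exact Submodule.smul_mem_smul hb (Submodule.mem_top (x := (1 : S ⧸ J)))

theorem uniformly_F_compatible_map_completion
    (R : Type u) [CommRing R] [IsNoetherianRing R] [IsLocalRing R]
    (p : ℕ) [Fact p.Prime] [CharP R p]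
    (hFF : IsFFinite R p)
    (R' : Type u) [CommRing R'] [IsNoetherianRing R'] [IsLocalRing R'] [CharP R' p]
    [Algebra R R']
    (hmax : maximalIdeal R' = (maximalIdeal R).map (algebraMap R R'))
    (hcomplete : IsAdicComplete (maximalIdeal R') R')
    (hquot : ∀ n : ℕ, Function.Bijective
      (Ideal.quotientMap ((maximalIdeal R ^ n).map (algebraMap R R')) (algebraMap R R')
        Ideal.le_comap_map))
    (𝔞 : Ideal R) (h𝔞 : UniformlyFCompatible R p 𝔞) :
    IsFFinite R' p ∧ UniformlyFCompatible R' p (𝔞.map (algebraMap R R')) := by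
  have hmaxpow (n : ℕ) : (maximalIdeal R ^ n).map (algebraMap R R') = maximalIdeal R' ^ n := by
    rw [Ideal.map_pow, hmax]
  have hsurj (n : ℕ) (y : R') :
      ∃ x : R, y - algebraMap R R' x ∈ (maximalIdeal R ^ n).map (algebraMap R R') := by
    obtain ⟨x, hx⟩ := (hquot n).2 (Ideal.Quotient.mk _ y)
    obtain ⟨x, rfl⟩ := Ideal.Quotient.mk_surjective x
    exact ⟨x, Ideal.Quotient.eq.1 hx.symm⟩
  have hinj (n : ℕ) (x : R)
      (hx : algebraMap R R' x ∈ (maximalIdeal R ^ n).map (algebraMap R R')) :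
      x ∈ maximalIdeal R ^ n := by
    rw [← Ideal.Quotient.eq_zero_iff_mem]
    refine (hquot n).1 ?_
    rw [map_zero, Ideal.quotientMap_mk]
    exact Ideal.Quotient.eq_zero_iff_mem.2 hx
  constructor
  · have : Module.Finite R (FrobAlg R p 1) := hFF
    obtain ⟨k, π, hπ⟩ := Module.Finite.exists_fin' R (FrobAlg R p 1)
    have := FrobAlg.isHausdorff p 1 (maximalIdeal R')
    refine Module.Finite.of_span_sup_smul_top (maximalIdeal R')
      (fun i => FrobAlg.mapAlgebraMap p 1 (T := R') (π (Pi.single i 1))) ?_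
    obtain ⟨K, hK⟩ := FrobAlg.exists_pow_of_mem_smul_top p 1 (maximalIdeal R') 1
    refine eq_top_iff.2 fun y _ => ?_
    obtain ⟨x, hx⟩ := hsurj K (y : R')
    rw [hmaxpow] at hx
    obtain ⟨v, hv⟩ := hπ (FrobAlg.of R p 1 x)
    refine Submodule.mem_sup.2 ⟨FrobAlg.mapAlgebraMap p 1 (FrobAlg.of R p 1 x), ?_, _,
      pow_one (maximalIdeal R') ▸ hK _ hx, add_sub_cancel (G := R') _ _⟩
    rw [← hv, pi_eq_sum_univ' v, map_sum, map_sum]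
    refine Submodule.sum_mem _ fun i _ => ?_
    rw [map_smul, LinearMap.map_smulₛₗ]
    exact Submodule.smul_mem _ _ (Submodule.subset_span ⟨i, rfl⟩)
  · intro n hn φ b hb
    have := FrobAlg.finite_of_isFFinite R p n hFF
    refine IsLocalRing.mem_of_forall_mem_sup_pow _ fun N => ?_
    obtain ⟨h, hh⟩ := (FrobAlg.restrict p n (S := R) φ).exists_sub_algebraMap_mem
      (maximalIdeal R) hsurj hinj N
    obtain ⟨K, hK⟩ := FrobAlg.exists_pow_of_mem_smul_top p n (maximalIdeal R') N
    obtain ⟨a, ha, hba⟩ := 𝔞.exists_mem_sub_algebraMap_mem _ (hsurj K) hb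
    rw [hmaxpow] at hba
    have h1 := Submodule.mem_map_of_mem (f := φ) (hK _ hba)
    rw [Submodule.map_smul''] at h1
    have h2 : φ (FrobAlg.of R' p n (b - algebraMap R R' a)) ∈ maximalIdeal R' ^ N := by
      simpa using (Submodule.smul_mono le_rfl le_top :
        _ ≤ maximalIdeal R' ^ N • (⊤ : Submodule R' R')) h1
    have h3 := hh (FrobAlg.of R p n a)
    rw [hmaxpow] at h3
    have hsum : φ (FrobAlg.of R' p n b) = algebraMap R R' (h (FrobAlg.of R p n a)) +
        (φ (FrobAlg.of R' p n (b - algebraMap R R' a)) +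
          (FrobAlg.restrict p n (S := R) φ (FrobAlg.of R p n a)
            - algebraMap R R' (h (FrobAlg.of R p n a)))) := by
      have : φ (FrobAlg.of R' p n (b - algebraMap R R' a)) = φ (FrobAlg.of R' p n b)
          - FrobAlg.restrict p n (S := R) φ (FrobAlg.of R p n a) := map_sub φ _ _
      rw [this]
      ring
    rw [hsum]
    exact Submodule.add_mem_sup (Ideal.mem_map_of_mem _ (h𝔞 n hn h a ha)) (add_mem h2 h3)
end
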